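/- arXiv:1709.05276 — 7 statements merged into one kernel-verified Lean document; each statement's English description precedes it below -/
import Mathlib

section
/- Let p be a strictly positive probability distribution in the simplex Δ7. Then p belongs to the model RBM_{3,2} if and only if at least one of the six conditions C1–C6 holds for p. -/
open Real

/-- A `2 × 2 × 2` real tensor. -/
abbrev Tensor : Type := Fin 2 → Fin 2 → Fin 2 → ℝ

/-- `p` is a probability distribution: nonnegative entries summing to 1 (membership in Δ₇). -/
def isDist (p : Tensor) : Prop :=
  (∀ i j k, 0 ≤ p i j k) ∧ (∑ i, ∑ j, ∑ k, p i j k) = 1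

/-- `q` is a nonnegative rank-one `2 × 2 × 2` tensor. -/
def rankOne (q : Tensor) : Prop :=
  ∃ a b c : Fin 2 → ℝ, (∀ i, 0 ≤ a i) ∧ (∀ i, 0 ≤ b i) ∧ (∀ i, 0 ≤ c i) ∧
    ∀ i j k, q i j k = a i * b j * c k

/-- Membership in the model `RBM_{3,2}`. -/
def inRBM32 (p : Tensor) : Prop :=
  isDist p ∧ ∃ q r s t : Tensor, rankOne q ∧ rankOne r ∧ rankOne s ∧ rankOne t ∧
    ∀ i j k, p i j k = (q i j k + r i j k) * (s i j k + t i j k)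

/-- Membership in the mixture model `M_{3,3}`. -/
def inM33 (p : Tensor) : Prop :=
  isDist p ∧ ∃ q r s : Tensor, rankOne q ∧ rankOne r ∧ rankOne s ∧
    ∀ i j k, p i j k = q i j k + r i j k + s i j k

def C1 (p : Tensor) : Prop :=
  p 0 0 0 * p 0 1 1 ≥ p 0 0 1 * p 0 1 0 ∧ p 1 0 0 * p 1 1 1 ≥ p 1 0 1 * p 1 1 0

def C2 (p : Tensor) : Prop :=
  p 0 0 0 * p 0 1 1 ≤ p 0 0 1 * p 0 1 0 ∧ p 1 0 0 * p 1 1 1 ≤ p 1 0 1 * p 1 1 0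

def C3 (p : Tensor) : Prop :=
  p 0 0 0 * p 1 0 1 ≥ p 0 0 1 * p 1 0 0 ∧ p 0 1 0 * p 1 1 1 ≥ p 0 1 1 * p 1 1 0

def C4 (p : Tensor) : Prop :=
  p 0 0 0 * p 1 0 1 ≤ p 0 0 1 * p 1 0 0 ∧ p 0 1 0 * p 1 1 1 ≤ p 0 1 1 * p 1 1 0

def C5 (p : Tensor) : Prop :=
  p 0 0 0 * p 1 1 0 ≥ p 1 0 0 * p 0 1 0 ∧ p 0 0 1 * p 1 1 1 ≥ p 1 0 1 * p 0 1 1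

def C6 (p : Tensor) : Prop :=
  p 0 0 0 * p 1 1 0 ≤ p 1 0 0 * p 0 1 0 ∧ p 0 0 1 * p 1 1 1 ≤ p 1 0 1 * p 0 1 1

lemma rankOne.swap {q : Tensor} (h : rankOne q) : rankOne fun i j k => q j i k := by
  obtain ⟨a, b, c, ha, hb, hc, h⟩ := h
  exact ⟨b, a, c, hb, ha, hc, fun i j k => by simp only [h]; ring⟩

lemma rankOne.rotate {q : Tensor} (h : rankOne q) : rankOne fun i j k => q k i j := by
  obtain ⟨a, b, c, ha, hb, hc, h⟩ := h
  exact ⟨b, c, a, hb, hc, ha, fun i j k => by simp only [h]; ring⟩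

lemma rankOne.flip {q : Tensor} (h : rankOne q) : rankOne fun i j k => q i j (1 - k) := by
  obtain ⟨a, b, c, ha, hb, hc, h⟩ := h
  exact ⟨a, b, fun k => c (1 - k), ha, hb, fun k => hc _, fun i j k => h i j (1 - k)⟩

/-- `p` is an entrywise product of two tensors of nonnegative rank at most two. -/
def IsMixtureProduct (p : Tensor) : Prop :=
  ∃ q r s t : Tensor, rankOne q ∧ rankOne r ∧ rankOne s ∧ rankOne t ∧
    ∀ i j k, p i j k = (q i j k + r i j k) * (s i j k + t i j k)

lemma IsMixtureProduct.swap {p : Tensor} (h : IsMixtureProduct p) :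
    IsMixtureProduct fun i j k => p j i k := by
  obtain ⟨q, r, s, t, hq, hr, hs, ht, h⟩ := h
  exact ⟨_, _, _, _, hq.swap, hr.swap, hs.swap, ht.swap, fun i j k => h j i k⟩

lemma IsMixtureProduct.rotate {p : Tensor} (h : IsMixtureProduct p) :
    IsMixtureProduct fun i j k => p k i j := by
  obtain ⟨q, r, s, t, hq, hr, hs, ht, h⟩ := h
  exact ⟨_, _, _, _, hq.rotate, hr.rotate, hs.rotate, ht.rotate, fun i j k => h k i j⟩

lemma IsMixtureProduct.flip {p : Tensor} (h : IsMixtureProduct p) :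
    IsMixtureProduct fun i j k => p i j (1 - k) := by
  obtain ⟨q, r, s, t, hq, hr, hs, ht, h⟩ := h
  exact ⟨_, _, _, _, hq.flip, hr.flip, hs.flip, ht.flip, fun i j k => h i j (1 - k)⟩

/-- One factor is constant `1` except in the corner `j = k = 1`, where it is the odds ratio of each
slice; the other has rank-one slices. -/
lemma C1.isMixtureProduct {p : Tensor} (hpos : ∀ i j k, 0 < p i j k) (h : C1 p) :
    IsMixtureProduct p := by
  have hodds : ∀ i, 0 ≤ p i 0 0 * p i 1 1 / (p i 0 1 * p i 1 0) - 1 := by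
    intro i
    have hden : 0 < p i 0 1 * p i 1 0 := mul_pos (hpos _ _ _) (hpos _ _ _)
    rw [sub_nonneg, one_le_div hden]
    fin_cases i
    · exact h.1
    · exact h.2
  refine ⟨fun _ _ _ => 1,
    fun i j k => (p i 0 0 * p i 1 1 / (p i 0 1 * p i 1 0) - 1) * ![0, 1] j * ![0, 1] k,
    fun i j k => ![1, 0] i * p 0 j 0 * (p 0 0 k / p 0 0 0),
    fun i j k => ![0, 1] i * p 1 j 0 * (p 1 0 k / p 1 0 0),
    ⟨1, 1, 1, by simp, by simp, by simp, by simp⟩,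
    ⟨_, _, _, hodds, by simp [Fin.forall_fin_two], by simp [Fin.forall_fin_two],
      fun _ _ _ => rfl⟩,
    ⟨_, fun j => p 0 j 0, fun k => p 0 0 k / p 0 0 0, by simp [Fin.forall_fin_two],
      fun j => (hpos _ _ _).le, fun k => (div_pos (hpos _ _ _) (hpos _ _ _)).le,
      fun _ _ _ => rfl⟩,
    ⟨_, fun j => p 1 j 0, fun k => p 1 0 k / p 1 0 0, by simp [Fin.forall_fin_two],
      fun j => (hpos _ _ _).le, fun k => (div_pos (hpos _ _ _) (hpos _ _ _)).le,
      fun _ _ _ => rfl⟩, ?_⟩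
  have hne : ∀ i j k, p i j k ≠ 0 := fun i j k => (hpos i j k).ne'
  intro i j k
  have h1 := hne 0 0 0
  have h2 := hne 0 0 1
  have h3 := hne 0 1 0
  have h4 := hne 1 0 0
  have h5 := hne 1 0 1
  have h6 := hne 1 1 0
  fin_cases i <;> fin_cases j <;> fin_cases k <;> simp <;> field_simp

lemma C2.isMixtureProduct {p : Tensor} (hpos : ∀ i j k, 0 < p i j k) (h : C2 p) :
    IsMixtureProduct p := by
  have h1 : C1 fun i j k => p i j (1 - k) := by simpa [C1, C2] using h
  simpa using (h1.isMixtureProduct fun i j k => hpos i j (1 - k)).flip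

/-- The slice determinants of a tensor of nonnegative rank at most two are, up to nonnegative
factors, the pairwise products of three real numbers. -/
lemma slice_dets_of_rankOne_add {q r : Tensor} (hq : rankOne q) (hr : rankOne r) :
    (∀ i j k, 0 ≤ q i j k + r i j k) ∧ ∃ (x y z : ℝ) (u v w : Fin 2 → ℝ),
      (∀ i, 0 ≤ u i) ∧ (∀ i, 0 ≤ v i) ∧ (∀ i, 0 ≤ w i) ∧
      (∀ i, (q i 0 0 + r i 0 0) * (q i 1 1 + r i 1 1) =
        (q i 0 1 + r i 0 1) * (q i 1 0 + r i 1 0) + u i * (y * z)) ∧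
      (∀ j, (q 0 j 0 + r 0 j 0) * (q 1 j 1 + r 1 j 1) =
        (q 0 j 1 + r 0 j 1) * (q 1 j 0 + r 1 j 0) + v j * (x * z)) ∧
      (∀ k, (q 0 0 k + r 0 0 k) * (q 1 1 k + r 1 1 k) =
        (q 1 0 k + r 1 0 k) * (q 0 1 k + r 0 1 k) + w k * (x * y)) := by
  obtain ⟨a, b, c, ha, hb, hc, hq⟩ := hq
  obtain ⟨a', b', c', ha', hb', hc', hr⟩ := hr
  refine ⟨fun i j k => ?_, a 0 * a' 1 - a 1 * a' 0, b 0 * b' 1 - b 1 * b' 0,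
    c 0 * c' 1 - c 1 * c' 0, fun i => a i * a' i, fun i => b i * b' i, fun i => c i * c' i,
    fun i => mul_nonneg (ha i) (ha' i), fun i => mul_nonneg (hb i) (hb' i),
    fun i => mul_nonneg (hc i) (hc' i), ?_, ?_, ?_⟩
  · rw [hq, hr]
    exact add_nonneg (mul_nonneg (mul_nonneg (ha i) (hb j)) (hc k))
      (mul_nonneg (mul_nonneg (ha' i) (hb' j)) (hc' k))
  all_goals
    intro i
    simp only [hq, hr]
    ring

lemma exists_pair_mul_nonneg (x y z : ℝ) : 0 ≤ y * z ∨ 0 ≤ x * z ∨ 0 ≤ x * y := by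
  rcases le_total 0 x with hx | hx <;> rcases le_total 0 y with hy | hy <;>
    rcases le_total 0 z with hz | hz <;>
    simp [mul_nonneg, mul_nonneg_of_nonpos_of_nonpos, hx, hy, hz]

lemma mul_mul_mul_le {a b c d a' b' c' d' : ℝ} (hc : 0 ≤ c) (hd : 0 ≤ d) (ha' : 0 ≤ a')
    (hb' : 0 ≤ b') (h : a * b ≤ c * d) (h' : a' * b' ≤ c' * d') :
    (a * a') * (b * b') ≤ (c * c') * (d * d') := by
  rw [mul_mul_mul_comm a, mul_mul_mul_comm c]
  exact mul_le_mul h h' (mul_nonneg ha' hb') (mul_nonneg hc hd)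

lemma IsMixtureProduct.exists_condition {p : Tensor} (h : IsMixtureProduct p) :
    C1 p ∨ C2 p ∨ C3 p ∨ C4 p ∨ C5 p ∨ C6 p := by
  obtain ⟨q, r, s, t, hq, hr, hs, ht, h⟩ := h
  obtain ⟨hqr, x, y, z, u, v, w, hu, hv, hw, h1, h2, h3⟩ := slice_dets_of_rankOne_add hq hr
  obtain ⟨hst, x', y', z', u', v', w', hu', hv', hw', h1', h2', h3'⟩ :=
    slice_dets_of_rankOne_add hs ht
  have hle : ∀ {e f g m : ℝ}, e = f + g * m → 0 ≤ g → 0 ≤ m → f ≤ e :=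
    fun he hg hm => by linarith [mul_nonneg hg hm]
  have hge : ∀ {e f g m : ℝ}, e = f + g * m → 0 ≤ g → m ≤ 0 → e ≤ f :=
    fun he hg hm => by linarith [mul_nonpos_of_nonneg_of_nonpos hg hm]
  simp only [C1, C2, C3, C4, C5, C6, h, ge_iff_le]
  rcases exists_pair_mul_nonneg (x * x') (y * y') (z * z') with hs | hs | hs <;>
    rw [mul_mul_mul_comm, mul_nonneg_iff] at hs <;> rcases hs with ⟨hm, hn⟩ | ⟨hm, hn⟩
  · left
    constructor <;> exact mul_mul_mul_le (hqr _ _ _) (hqr _ _ _) (hst _ _ _) (hst _ _ _)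
      (hle (h1 _) (hu _) hm) (hle (h1' _) (hu' _) hn)
  · right; left
    constructor <;> exact mul_mul_mul_le (hqr _ _ _) (hqr _ _ _) (hst _ _ _) (hst _ _ _)
      (hge (h1 _) (hu _) hm) (hge (h1' _) (hu' _) hn)
  · right; right; left
    constructor <;> exact mul_mul_mul_le (hqr _ _ _) (hqr _ _ _) (hst _ _ _) (hst _ _ _)
      (hle (h2 _) (hv _) hm) (hle (h2' _) (hv' _) hn)
  · right; right; right; left
    constructor <;> exact mul_mul_mul_le (hqr _ _ _) (hqr _ _ _) (hst _ _ _) (hst _ _ _)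
      (hge (h2 _) (hv _) hm) (hge (h2' _) (hv' _) hn)
  · right; right; right; right; left
    constructor <;> exact mul_mul_mul_le (hqr _ _ _) (hqr _ _ _) (hst _ _ _) (hst _ _ _)
      (hle (h3 _) (hw _) hm) (hle (h3' _) (hw' _) hn)
  · right; right; right; right; right
    constructor <;> exact mul_mul_mul_le (hqr _ _ _) (hqr _ _ _) (hst _ _ _) (hst _ _ _)
      (hge (h3 _) (hw _) hm) (hge (h3' _) (hw' _) hn)

theorem stmt0 (p : Tensor) (hp : isDist p) (hpos : ∀ i j k, 0 < p i j k) :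
    inRBM32 p ↔ (C1 p ∨ C2 p ∨ C3 p ∨ C4 p ∨ C5 p ∨ C6 p) := by
  refine ⟨fun h => IsMixtureProduct.exists_condition h.2, fun h => ⟨hp, ?_⟩⟩
  change IsMixtureProduct p
  rcases h with h | h | h | h | h | h
  · exact h.isMixtureProduct hpos
  · exact h.isMixtureProduct hpos
  · have h1 : C1 fun i j k => p j i k := h
    exact (h1.isMixtureProduct fun i j k => hpos j i k).swap
  · have h1 : C2 fun i j k => p j i k := h
    exact (h1.isMixtureProduct fun i j k => hpos j i k).swap
  · have h1 : C1 fun i j k => p j k i := by simpa [C1, C5, mul_comm] using h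
    exact (h1.isMixtureProduct fun i j k => hpos j k i).rotate
  · have h1 : C2 fun i j k => p j k i := by simpa [C2, C6, mul_comm] using h
    exact (h1.isMixtureProduct fun i j k => hpos j k i).rotate
end

section
/- W = X + Y, where X + Y = { x + y : x ∈ X, y ∈ Y } is the Minkowski sum; that is, every point of W can be written as the sum of a point of X and a point of Y, and every such sum lies in W. -/
open scoped Pointwise

def Xset : Set Tensor :=
  {l | l 0 0 0 + l 0 1 1 - l 0 0 1 - l 0 1 0 ≥ 0 ∧
       l 1 0 0 + l 1 1 1 - l 1 0 1 - l 1 1 0 ≥ 0 ∧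
       l 0 0 0 + l 1 0 1 - l 0 0 1 - l 1 0 0 ≥ 0 ∧
       l 0 1 0 + l 1 1 1 - l 0 1 1 - l 1 1 0 ≥ 0 ∧
       l 0 0 0 + l 1 1 0 - l 0 1 0 - l 1 0 0 ≥ 0 ∧
       l 0 0 1 + l 1 1 1 - l 0 1 1 - l 1 0 1 ≥ 0}

def Yset : Set Tensor :=
  {l | l 0 0 0 + l 0 1 1 - l 0 0 1 - l 0 1 0 ≥ 0 ∧
       l 1 0 0 + l 1 1 1 - l 1 0 1 - l 1 1 0 ≥ 0 ∧
       l 0 0 0 + l 1 0 1 - l 0 0 1 - l 1 0 0 ≤ 0 ∧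
       l 0 1 0 + l 1 1 1 - l 0 1 1 - l 1 1 0 ≤ 0 ∧
       l 0 0 0 + l 1 1 0 - l 0 1 0 - l 1 0 0 ≤ 0 ∧
       l 0 0 1 + l 1 1 1 - l 0 1 1 - l 1 0 1 ≤ 0}

def Wset : Set Tensor :=
  {l | l 0 0 0 + l 0 1 1 - l 0 0 1 - l 0 1 0 ≥ 0 ∧
       l 1 0 0 + l 1 1 1 - l 1 0 1 - l 1 1 0 ≥ 0}

/-- `W` equals the Minkowski sum `X + Y`. -/
theorem stmt1 : Wset = Xset + Yset := by
  ext l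
  constructor
  · rintro ⟨h₀, h₁⟩
    -- A multiple of `-i (j + k)` has vanishing `(j, k)`-differences and negative other ones.
    obtain ⟨M, hM, hb₀, hb₁, hc₀, hc₁⟩ : ∃ M : ℝ, 0 ≤ M ∧
        0 ≤ l 0 0 0 + l 1 0 1 - l 0 0 1 - l 1 0 0 + M ∧
        0 ≤ l 0 1 0 + l 1 1 1 - l 0 1 1 - l 1 1 0 + M ∧
        0 ≤ l 0 0 0 + l 1 1 0 - l 0 1 0 - l 1 0 0 + M ∧
        0 ≤ l 0 0 1 + l 1 1 1 - l 0 1 1 - l 1 0 1 + M := by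
      refine ⟨∑ i, ∑ j, ∑ k, |l i j k|, by positivity, ?_⟩
      simp only [Fin.sum_univ_two]
      have bound := fun i j k => And.intro (neg_abs_le (l i j k)) (le_abs_self (l i j k))
      have h000 := bound 0 0 0
      have h001 := bound 0 0 1
      have h010 := bound 0 1 0
      have h011 := bound 0 1 1
      have h100 := bound 1 0 0
      have h101 := bound 1 0 1
      have h110 := bound 1 1 0
      have h111 := bound 1 1 1
      have nonneg := fun i j k => abs_nonneg (l i j k)
      refine ⟨?_, ?_, ?_, ?_⟩ <;>
        linarith [nonneg 0 0 0, nonneg 0 0 1, nonneg 0 1 0, nonneg 0 1 1,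
          nonneg 1 0 0, nonneg 1 0 1, nonneg 1 1 0, nonneg 1 1 1]
    let y : Tensor := fun i j k => -M * ((i : ℕ) : ℝ) * (((j : ℕ) : ℝ) + ((k : ℕ) : ℝ))
    refine Set.mem_add.2 ⟨l - y, ?_, y, ?_, sub_add_cancel l y⟩
    · simp only [Xset, Set.mem_ofPred_eq, Pi.sub_apply, y, Fin.val_zero, Fin.val_one,
        Nat.cast_zero, Nat.cast_one]
      refine ⟨?_, ?_, ?_, ?_, ?_, ?_⟩ <;> linarith
    · simp only [Yset, Set.mem_ofPred_eq, y, Fin.val_zero, Fin.val_one,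
        Nat.cast_zero, Nat.cast_one]
      refine ⟨?_, ?_, ?_, ?_, ?_, ?_⟩ <;> linarith
  · intro h
    obtain ⟨x, ⟨hx₀, hx₁, -⟩, y, ⟨hy₀, hy₁, -⟩, rfl⟩ := Set.mem_add.1 h
    simp only [Wset, Set.mem_ofPred_eq, Pi.add_apply]
    constructor <;> linarith
end

section
/- The model M_{3,3} equals the topological closure of the model RBM_{3,2} (closure taken in ℝ⁸, viewing both models as subsets of the simplex Δ7). -/
open Real

/-! ### Closure of the Hadamard model inside the union of the six semialgebraic sets -/

/-- The union of the six basic semialgebraic sets. -/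
def SliceSigns (p : Tensor) : Prop :=
  C1 p ∨ C2 p ∨ C3 p ∨ C4 p ∨ C5 p ∨ C6 p

/-- The determinant of two vectors of the plane. -/
def det₂ (v w : Fin 2 → ℝ) : ℝ := v 0 * w 1 - v 1 * w 0

lemma rankOne.nonneg {q : Tensor} (hq : rankOne q) (i j k : Fin 2) : 0 ≤ q i j k := by
  obtain ⟨a, b, c, ha, hb, hc, h⟩ := hq
  rw [h]
  exact mul_nonneg (mul_nonneg (ha i) (hb j)) (hc k)

/-- The slice determinants of a sum of two nonnegative rank-one tensors have signs governed by
the three determinants of the pairs of factors. -/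
lemma exists_signs_of_rankOne_add {q r : Tensor} (hq : rankOne q) (hr : rankOne r) :
    ∃ α β γ : ℝ,
      (0 ≤ β * γ → C1 (q + r)) ∧ (β * γ ≤ 0 → C2 (q + r)) ∧
      (0 ≤ α * γ → C3 (q + r)) ∧ (α * γ ≤ 0 → C4 (q + r)) ∧
      (0 ≤ α * β → C5 (q + r)) ∧ (α * β ≤ 0 → C6 (q + r)) := by
  obtain ⟨a, b, c, ha, hb, hc, h⟩ := hq
  obtain ⟨a', b', c', ha', hb', hc', h'⟩ := hr
  have ma (i) : 0 ≤ a i * a' i := mul_nonneg (ha i) (ha' i)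
  have mb (i) : 0 ≤ b i * b' i := mul_nonneg (hb i) (hb' i)
  have mc (i) : 0 ≤ c i * c' i := mul_nonneg (hc i) (hc' i)
  refine ⟨det₂ a a', det₂ b b', det₂ c c', ?_, ?_, ?_, ?_, ?_, ?_⟩ <;> intro hs <;>
    simp only [C1, C2, C3, C4, C5, C6, Pi.add_apply, h, h', det₂] at hs ⊢
  · constructor
    · linarith [mul_nonneg (ma 0) hs]
    · linarith [mul_nonneg (ma 1) hs]
  · constructor
    · linarith [mul_nonpos_of_nonneg_of_nonpos (ma 0) hs]
    · linarith [mul_nonpos_of_nonneg_of_nonpos (ma 1) hs]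
  · constructor
    · linarith [mul_nonneg (mb 0) hs]
    · linarith [mul_nonneg (mb 1) hs]
  · constructor
    · linarith [mul_nonpos_of_nonneg_of_nonpos (mb 0) hs]
    · linarith [mul_nonpos_of_nonneg_of_nonpos (mb 1) hs]
  · constructor
    · linarith [mul_nonneg (mc 0) hs]
    · linarith [mul_nonneg (mc 1) hs]
  · constructor
    · linarith [mul_nonpos_of_nonneg_of_nonpos (mc 0) hs]
    · linarith [mul_nonpos_of_nonneg_of_nonpos (mc 1) hs]

lemma mul_mul_le_mul_mul_of_nonneg {x y z w x' y' z' w' : ℝ} (hx : 0 ≤ x) (hy : 0 ≤ y)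
    (hz' : 0 ≤ z') (hw' : 0 ≤ w') (h : z * w ≤ x * y) (h' : z' * w' ≤ x' * y') :
    z * z' * (w * w') ≤ x * x' * (y * y') := by
  have := mul_le_mul h h' (mul_nonneg hz' hw') (mul_nonneg hx hy)
  linarith

lemma exists_mul_mul_nonneg (α β γ α' β' γ' : ℝ) :
    0 ≤ (β * γ) * (β' * γ') ∨ 0 ≤ (α * γ) * (α' * γ') ∨ 0 ≤ (α * β) * (α' * β') := by
  rw [mul_mul_mul_comm β, mul_mul_mul_comm α γ, mul_mul_mul_comm α β]
  simp only [mul_nonneg_iff (a := _ * _) (b := _ * _)]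
  rcases le_total 0 (α * α') with h | h <;> rcases le_total 0 (β * β') with h' | h' <;>
    rcases le_total 0 (γ * γ') with h'' | h'' <;> tauto

lemma SliceSigns.mul_of_rankOne {q r s t : Tensor} (hq : rankOne q) (hr : rankOne r)
    (hs : rankOne s) (ht : rankOne t) : SliceSigns ((q + r) * (s + t)) := by
  have hm (i j k) : 0 ≤ (q + r) i j k := add_nonneg (hq.nonneg i j k) (hr.nonneg i j k)
  have hn (i j k) : 0 ≤ (s + t) i j k := add_nonneg (hs.nonneg i j k) (ht.nonneg i j k)
  obtain ⟨α, β, γ, h1, h2, h3, h4, h5, h6⟩ := exists_signs_of_rankOne_add hq hr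
  obtain ⟨α', β', γ', k1, k2, k3, k4, k5, k6⟩ := exists_signs_of_rankOne_add hs ht
  generalize q + r = m at *
  generalize s + t = n at *
  have mul {i j k i' j' k' i₁ j₁ k₁ i₁' j₁' k₁' : Fin 2}
      (h : m i₁ j₁ k₁ * m i₁' j₁' k₁' ≤ m i j k * m i' j' k')
      (h' : n i₁ j₁ k₁ * n i₁' j₁' k₁' ≤ n i j k * n i' j' k') :
      (m * n) i₁ j₁ k₁ * (m * n) i₁' j₁' k₁' ≤ (m * n) i j k * (m * n) i' j' k' :=
    mul_mul_le_mul_mul_of_nonneg (hm _ _ _) (hm _ _ _) (hn _ _ _) (hn _ _ _) h h'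
  unfold SliceSigns
  rcases exists_mul_mul_nonneg α β γ α' β' γ' with h | h | h <;>
    rcases mul_nonneg_iff.1 h with ⟨u, v⟩ | ⟨u, v⟩
  · left
    exact ⟨mul (h1 u).1 (k1 v).1, mul (h1 u).2 (k1 v).2⟩
  · right; left
    exact ⟨mul (h2 u).1 (k2 v).1, mul (h2 u).2 (k2 v).2⟩
  · right; right; left
    exact ⟨mul (h3 u).1 (k3 v).1, mul (h3 u).2 (k3 v).2⟩
  · right; right; right; left
    exact ⟨mul (h4 u).1 (k4 v).1, mul (h4 u).2 (k4 v).2⟩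
  · right; right; right; right; left
    exact ⟨mul (h5 u).1 (k5 v).1, mul (h5 u).2 (k5 v).2⟩
  · right; right; right; right; right
    exact ⟨mul (h6 u).1 (k6 v).1, mul (h6 u).2 (k6 v).2⟩

lemma isClosed_setOf_isDist : IsClosed {p : Tensor | isDist p} := by
  simp only [isDist, Set.ofPred_and, Set.ofPred_forall]
  refine IsClosed.inter ?_ (isClosed_eq (by fun_prop) (by fun_prop))
  exact isClosed_iInter fun i => isClosed_iInter fun j => isClosed_iInter fun k =>
    isClosed_le (by fun_prop) (by fun_prop)

lemma isClosed_setOf_sliceSigns : IsClosed {p : Tensor | SliceSigns p} := by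
  simp only [SliceSigns, C1, C2, C3, C4, C5, C6, ge_iff_le, Set.ofPred_and, Set.ofPred_or]
  repeat' first
    | apply IsClosed.union
    | apply IsClosed.inter
    | exact isClosed_le (by fun_prop) (by fun_prop)

lemma closure_setOf_inRBM32_subset :
    closure {p : Tensor | inRBM32 p} ⊆ {p | isDist p ∧ SliceSigns p} := by
  refine closure_minimal ?_ (isClosed_setOf_isDist.inter isClosed_setOf_sliceSigns)
  rintro p ⟨hp, q, r, s, t, hq, hr, hs, ht, h⟩
  refine ⟨hp, ?_⟩
  have : p = (q + r) * (s + t) := by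
    funext i j k
    simp [h]
  rw [this]
  exact .mul_of_rankOne hq hr hs ht

/-! ### Mixtures of three products lie in the union of the six semialgebraic sets -/

/-- `u` is a nonnegative combination of `v` and `w`. -/
def Between (u v w : Fin 2 → ℝ) : Prop :=
  ∃ l m : ℝ, 0 ≤ l ∧ 0 ≤ m ∧ ∀ i, u i = l * v i + m * w i

lemma Between.symm {u v w : Fin 2 → ℝ} (h : Between u v w) : Between u w v := by
  obtain ⟨l, m, hl, hm, h⟩ := h
  exact ⟨m, l, hm, hl, fun i => by rw [h, add_comm]⟩

lemma between_of_det₂_eq_zero {u v : Fin 2 → ℝ} (w : Fin 2 → ℝ) (hu : ∀ i, 0 ≤ u i)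
    (hv : ∀ i, 0 ≤ v i) (h : det₂ u v = 0) : Between u v w ∨ Between v u w := by
  unfold det₂ at h
  rcases (hv 0).eq_or_lt with h0 | h0
  · rcases (hv 1).eq_or_lt with h1 | h1
    · right
      refine ⟨0, 0, le_rfl, le_rfl, ?_⟩
      simp [Fin.forall_fin_two, ← h0, ← h1]
    · left
      refine ⟨u 1 / v 1, 0, div_nonneg (hu 1) h1.le, le_rfl, ?_⟩
      simp only [Fin.forall_fin_two]
      constructor <;> field_simp <;> linarith
  · left
    refine ⟨u 0 / v 0, 0, div_nonneg (hu 0) h0.le, le_rfl, ?_⟩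
    simp only [Fin.forall_fin_two]
    constructor <;> field_simp <;> linarith

lemma between_of_det₂_div {u v w : Fin 2 → ℝ} (h : det₂ v w ≠ 0)
    (hl : 0 ≤ det₂ u w / det₂ v w) (hm : 0 ≤ det₂ v u / det₂ v w) : Between u v w := by
  refine ⟨_, _, hl, hm, ?_⟩
  simp only [Fin.forall_fin_two]
  constructor <;> field_simp <;> simp only [det₂] <;> ring

lemma det₂_swap (v w : Fin 2 → ℝ) : det₂ v w = -det₂ w v := by
  simp only [det₂]
  ring

/-- Among three vectors of the nonnegative quadrant, one lies between the other two. -/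
lemma exists_mem_between {u v w : Fin 2 → ℝ} (hu : ∀ i, 0 ≤ u i) (hv : ∀ i, 0 ≤ v i)
    (hw : ∀ i, 0 ≤ w i) : Between u v w ∨ Between v u w ∨ Between w u v := by
  by_cases huv : det₂ u v = 0
  · rcases between_of_det₂_eq_zero w hu hv huv with h | h <;> tauto
  by_cases huw : det₂ u w = 0
  · rcases between_of_det₂_eq_zero v hu hw huw with h | h
    · exact .inl h.symm
    · tauto
  by_cases hvw : det₂ v w = 0
  · rcases between_of_det₂_eq_zero u hv hw hvw with h | h
    · exact .inr (.inl h.symm)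
    · exact .inr (.inr h.symm)
  have e : ∀ i, det₂ u w * v i = det₂ v w * u i + det₂ u v * w i := by
    simp only [Fin.forall_fin_two, det₂]
    constructor <;> ring
  have z0 := e 0
  have z1 := e 1
  have hu0 := hu 0; have hu1 := hu 1; have hv0 := hv 0; have hv1 := hv 1
  have hw0 := hw 0; have hw1 := hw 1
  rcases lt_or_gt_of_ne huv with a | a <;> rcases lt_or_gt_of_ne huw with b | b <;>
    rcases lt_or_gt_of_ne hvw with c | c
  · refine .inr (.inl (between_of_det₂_div huw ?_ ?_))
    · exact div_nonneg_of_nonpos c.le b.le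
    · exact div_nonneg_of_nonpos a.le b.le
  · refine .inr (.inr (between_of_det₂_div huv ?_ ?_))
    · rw [det₂_swap]
      exact div_nonneg_of_nonpos (by linarith) a.le
    · exact div_nonneg_of_nonpos b.le a.le
  · exfalso
    have p0 := mul_nonneg b.le hv0
    have p1 := mul_nonneg b.le hv1
    have q0 := mul_nonneg (neg_nonneg.2 c.le) hu0
    have q1 := mul_nonneg (neg_nonneg.2 c.le) hu1
    have r0 := mul_nonneg (neg_nonneg.2 a.le) hw0
    have r1 := mul_nonneg (neg_nonneg.2 a.le) hw1
    have v0 : v 0 = 0 := by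
      have : det₂ u w * v 0 = 0 := by linarith
      exact (mul_eq_zero.1 this).resolve_left huw
    have v1 : v 1 = 0 := by
      have : det₂ u w * v 1 = 0 := by linarith
      exact (mul_eq_zero.1 this).resolve_left huw
    exact huv (by simp [det₂, v0, v1])
  · refine .inl (between_of_det₂_div hvw ?_ ?_)
    · exact div_nonneg b.le c.le
    · rw [det₂_swap]
      exact div_nonneg (by linarith) c.le
  · refine .inl (between_of_det₂_div hvw ?_ ?_)
    · exact div_nonneg_of_nonpos b.le c.le
    · rw [det₂_swap]
      exact div_nonneg_of_nonpos (by linarith) c.le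
  · exfalso
    have p0 := mul_nonneg (neg_nonneg.2 b.le) hv0
    have p1 := mul_nonneg (neg_nonneg.2 b.le) hv1
    have q0 := mul_nonneg c.le hu0
    have q1 := mul_nonneg c.le hu1
    have r0 := mul_nonneg a.le hw0
    have r1 := mul_nonneg a.le hw1
    have v0 : v 0 = 0 := by
      have : det₂ u w * v 0 = 0 := by linarith
      exact (mul_eq_zero.1 this).resolve_left huw
    have v1 : v 1 = 0 := by
      have : det₂ u w * v 1 = 0 := by linarith
      exact (mul_eq_zero.1 this).resolve_left huw
    exact huv (by simp [det₂, v0, v1])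
  · refine .inr (.inr (between_of_det₂_div huv ?_ ?_))
    · rw [det₂_swap]
      exact div_nonneg (by linarith) a.le
    · exact div_nonneg b.le a.le
  · refine .inr (.inl (between_of_det₂_div huw ?_ ?_))
    · exact div_nonneg c.le b.le
    · exact div_nonneg a.le b.le

/-- The determinant of the matrix `x • b ⊗ c + y • b' ⊗ c' + z • b'' ⊗ c''`. -/
def mixDet (x y z : ℝ) (b b' b'' c c' c'' : Fin 2 → ℝ) : ℝ :=
  x * y * (det₂ b b' * det₂ c c') + x * z * (det₂ b b'' * det₂ c c'') +
    det₂ b' b'' * det₂ c' c'' * (y * z)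

/-- If the same term is between the other two in two directions, all slice determinants in the third
direction have the same sign. -/
lemma mixDet_same_sign {b b' b'' c c' c'' : Fin 2 → ℝ} (hb : Between b b' b'')
    (hc : Between c c' c'') :
    (∀ x y z : ℝ, 0 ≤ x → 0 ≤ y → 0 ≤ z → 0 ≤ mixDet x y z b b' b'' c c' c'') ∨
    (∀ x y z : ℝ, 0 ≤ x → 0 ≤ y → 0 ≤ z → mixDet x y z b b' b'' c c' c'' ≤ 0) := by
  obtain ⟨l, m, hl, hm, h⟩ := hb
  obtain ⟨l', m', hl', hm', h'⟩ := hc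
  have e (x y z : ℝ) : mixDet x y z b b' b'' c c' c'' =
      (det₂ b' b'' * det₂ c' c'') * (y * z + x * y * (m * m') + x * z * (l * l')) := by
    simp only [mixDet, det₂, h, h']
    ring
  simp only [e]
  rcases le_total 0 (det₂ b' b'' * det₂ c' c'') with hs | hs
  · left
    intro x y z hx hy hz
    exact mul_nonneg hs (by positivity)
  · right
    intro x y z hx hy hz
    exact mul_nonpos_of_nonpos_of_nonneg hs (by positivity)

/-- If three different terms are between the others in the three directions, then the slice
determinants have a common sign in one of the first two directions. -/
lemma mixDet_same_sign_of_distinct {a a' a'' b b' b'' c c' c'' : Fin 2 → ℝ}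
    (ha' : ∀ i, 0 ≤ a' i) (ha'' : ∀ i, 0 ≤ a'' i)
    (hb : ∀ i, 0 ≤ b i) (hb'' : ∀ i, 0 ≤ b'' i)
    (hA : Between a a' a'') (hB : Between b' b b'') (hC : Between c'' c c') :
    (∀ i, 0 ≤ mixDet (a i) (a' i) (a'' i) b b' b'' c c' c'') ∨
    (∀ i, mixDet (a i) (a' i) (a'' i) b b' b'' c c' c'' ≤ 0) ∨
    (∀ i, 0 ≤ mixDet (b i) (b' i) (b'' i) a a' a'' c c' c'') ∨
    (∀ i, mixDet (b i) (b' i) (b'' i) a a' a'' c c' c'' ≤ 0) := by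
  obtain ⟨l, m, hl, hm, hA⟩ := hA
  obtain ⟨l', m', hl', hm', hB⟩ := hB
  obtain ⟨l'', m'', hl'', hm'', hC⟩ := hC
  have e1 (i) : mixDet (a i) (a' i) (a'' i) b b' b'' c c' c'' =
      (det₂ b b'' * det₂ c c') *
        (a i * a' i * m' + a i * a'' i * m'' - a' i * a'' i * (l' * l'')) := by
    simp only [mixDet, det₂, hB, hC]
    ring
  have e2 (i) : mixDet (b i) (b' i) (b'' i) a a' a'' c c' c'' =
      (det₂ a' a'' * det₂ c c') *
        (b i * b'' i * (l * m'') - b i * b' i * m - b' i * b'' i * l'') := by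
    simp only [mixDet, det₂, hA, hC]
    ring
  simp only [e1, e2]
  have key : (∀ i, 0 ≤ a i * a' i * m' + a i * a'' i * m'' - a' i * a'' i * (l' * l'')) ∨
      (∀ i, b i * b'' i * (l * m'') - b i * b' i * m - b' i * b'' i * l'' ≤ 0) := by
    rcases le_total (l' * l'') (l * m'') with h | h
    · left
      intro i
      have t : a i * a' i * m' + a i * a'' i * m'' - a' i * a'' i * (l' * l'') =
          a' i * a'' i * (l * m'' - l' * l'') + m * a'' i * a'' i * m'' + a i * a' i * m' := by
        rw [hA]
        ring
      have hai : 0 ≤ a i := by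
        rw [hA]
        exact add_nonneg (mul_nonneg hl (ha' i)) (mul_nonneg hm (ha'' i))
      have := ha' i
      have := ha'' i
      have := sub_nonneg.2 h
      rw [t]
      positivity
    · right
      intro i
      have t : b i * b'' i * (l * m'') - b i * b' i * m - b' i * b'' i * l'' =
          -(b i * b'' i * (l' * l'' - l * m'') + m' * b'' i * b'' i * l'' + b i * b' i * m) := by
        rw [hB]
        ring
      have hbi : 0 ≤ b' i := by
        rw [hB]
        exact add_nonneg (mul_nonneg hl' (hb i)) (mul_nonneg hm' (hb'' i))
      have := hb i
      have := hb'' i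
      have := sub_nonneg.2 h
      rw [t, neg_nonpos]
      positivity
  rcases key with h | h
  · rcases le_total 0 (det₂ b b'' * det₂ c c') with hs | hs
    · exact .inl fun i => mul_nonneg hs (h i)
    · exact .inr (.inl fun i => mul_nonpos_of_nonpos_of_nonneg hs (h i))
  · rcases le_total 0 (det₂ a' a'' * det₂ c c') with hs | hs
    · exact .inr (.inr (.inr fun i => mul_nonpos_of_nonneg_of_nonpos hs (h i)))
    · exact .inr (.inr (.inl fun i => mul_nonneg_of_nonpos_of_nonpos hs (h i)))

/-- The sum of three rank-one tensors. -/
def mix (a a' a'' b b' b'' c c' c'' : Fin 2 → ℝ) : Tensor := fun i j k =>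
  a i * b j * c k + a' i * b' j * c' k + a'' i * b'' j * c'' k

section Mix

variable {a a' a'' b b' b'' c c' c'' : Fin 2 → ℝ}

lemma mix_rotate : mix a a' a'' b b' b'' c c' c'' = mix a' a'' a b' b'' b c' c'' c := by
  funext i j k
  simp only [mix]
  ring

lemma mix_swap : mix a a' a'' b b' b'' c c' c'' = mix a' a a'' b' b b'' c' c c'' := by
  funext i j k
  simp only [mix]
  ring

lemma mixDet_fst (i : Fin 2) : mixDet (a i) (a' i) (a'' i) b b' b'' c c' c'' =
    mix a a' a'' b b' b'' c c' c'' i 0 0 * mix a a' a'' b b' b'' c c' c'' i 1 1 -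
    mix a a' a'' b b' b'' c c' c'' i 0 1 * mix a a' a'' b b' b'' c c' c'' i 1 0 := by
  simp only [mixDet, mix, det₂]
  ring

lemma mixDet_snd (j : Fin 2) : mixDet (b j) (b' j) (b'' j) a a' a'' c c' c'' =
    mix a a' a'' b b' b'' c c' c'' 0 j 0 * mix a a' a'' b b' b'' c c' c'' 1 j 1 -
    mix a a' a'' b b' b'' c c' c'' 0 j 1 * mix a a' a'' b b' b'' c c' c'' 1 j 0 := by
  simp only [mixDet, mix, det₂]
  ring

lemma mixDet_trd (k : Fin 2) : mixDet (c k) (c' k) (c'' k) a a' a'' b b' b'' =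
    mix a a' a'' b b' b'' c c' c'' 0 0 k * mix a a' a'' b b' b'' c c' c'' 1 1 k -
    mix a a' a'' b b' b'' c c' c'' 1 0 k * mix a a' a'' b b' b'' c c' c'' 0 1 k := by
  simp only [mixDet, mix, det₂]
  ring

lemma C1_mix (h : ∀ i, 0 ≤ mixDet (a i) (a' i) (a'' i) b b' b'' c c' c'') :
    C1 (mix a a' a'' b b' b'' c c' c'') := by
  simp only [mixDet_fst, sub_nonneg] at h
  exact ⟨h 0, h 1⟩

lemma C2_mix (h : ∀ i, mixDet (a i) (a' i) (a'' i) b b' b'' c c' c'' ≤ 0) :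
    C2 (mix a a' a'' b b' b'' c c' c'') := by
  simp only [mixDet_fst, sub_nonpos] at h
  exact ⟨h 0, h 1⟩

lemma C3_mix (h : ∀ j, 0 ≤ mixDet (b j) (b' j) (b'' j) a a' a'' c c' c'') :
    C3 (mix a a' a'' b b' b'' c c' c'') := by
  simp only [mixDet_snd, sub_nonneg] at h
  exact ⟨h 0, h 1⟩

lemma C4_mix (h : ∀ j, mixDet (b j) (b' j) (b'' j) a a' a'' c c' c'' ≤ 0) :
    C4 (mix a a' a'' b b' b'' c c' c'') := by
  simp only [mixDet_snd, sub_nonpos] at h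
  exact ⟨h 0, h 1⟩

lemma C5_mix (h : ∀ k, 0 ≤ mixDet (c k) (c' k) (c'' k) a a' a'' b b' b'') :
    C5 (mix a a' a'' b b' b'' c c' c'') := by
  simp only [mixDet_trd, sub_nonneg] at h
  exact ⟨h 0, h 1⟩

lemma C6_mix (h : ∀ k, mixDet (c k) (c' k) (c'' k) a a' a'' b b' b'' ≤ 0) :
    C6 (mix a a' a'' b b' b'' c c' c'') := by
  simp only [mixDet_trd, sub_nonpos] at h
  exact ⟨h 0, h 1⟩

lemma sliceSigns_mix_of_distinct
    (ha' : ∀ i, 0 ≤ a' i) (ha'' : ∀ i, 0 ≤ a'' i) (hb : ∀ i, 0 ≤ b i) (hb'' : ∀ i, 0 ≤ b'' i)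
    (hA : Between a a' a'') (hB : Between b' b b'') (hC : Between c'' c c') :
    SliceSigns (mix a a' a'' b b' b'' c c' c'') := by
  rcases mixDet_same_sign_of_distinct ha' ha'' hb hb'' hA hB hC with h | h | h | h
  · exact .inl (C1_mix h)
  · exact .inr (.inl (C2_mix h))
  · exact .inr (.inr (.inl (C3_mix h)))
  · exact .inr (.inr (.inr (.inl (C4_mix h))))

/-- A mixture in which the first term is between the other two in the first direction. -/
lemma sliceSigns_mix_of_between
    (ha : ∀ i, 0 ≤ a i) (ha' : ∀ i, 0 ≤ a' i) (ha'' : ∀ i, 0 ≤ a'' i)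
    (hb : ∀ i, 0 ≤ b i) (hb' : ∀ i, 0 ≤ b' i) (hb'' : ∀ i, 0 ≤ b'' i)
    (hc : ∀ i, 0 ≤ c i) (hc' : ∀ i, 0 ≤ c' i) (hc'' : ∀ i, 0 ≤ c'' i)
    (hA : Between a a' a'') : SliceSigns (mix a a' a'' b b' b'' c c' c'') := by
  have same_bc {a a' a'' b b' b'' c c' c'' : Fin 2 → ℝ}
      (ha : ∀ i, 0 ≤ a i) (ha' : ∀ i, 0 ≤ a' i) (ha'' : ∀ i, 0 ≤ a'' i)
      (hB : Between b b' b'') (hC : Between c c' c'') :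
      SliceSigns (mix a a' a'' b b' b'' c c' c'') := by
    rcases mixDet_same_sign hB hC with h | h
    · exact .inl (C1_mix fun i => h _ _ _ (ha i) (ha' i) (ha'' i))
    · exact .inr (.inl (C2_mix fun i => h _ _ _ (ha i) (ha' i) (ha'' i)))
  rcases exists_mem_between hb hb' hb'' with hB | hB | hB
  · rcases mixDet_same_sign hA hB with h | h
    · exact .inr (.inr (.inr (.inr (.inl
        (C5_mix fun i => h _ _ _ (hc i) (hc' i) (hc'' i))))))
    · exact .inr (.inr (.inr (.inr (.inr
        (C6_mix fun i => h _ _ _ (hc i) (hc' i) (hc'' i))))))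
  all_goals
    rcases exists_mem_between hc hc' hc'' with hC | hC | hC
    · rcases mixDet_same_sign hA hC with h | h
      · exact .inr (.inr (.inl (C3_mix fun i => h _ _ _ (hb i) (hb' i) (hb'' i))))
      · exact .inr (.inr (.inr (.inl (C4_mix fun i => h _ _ _ (hb i) (hb' i) (hb'' i)))))
  · rw [mix_swap]
    exact same_bc ha' ha ha'' hB hC
  · exact sliceSigns_mix_of_distinct ha' ha'' hb hb'' hA hB hC
  · rw [mix_swap, mix_rotate]
    exact sliceSigns_mix_of_distinct ha'' ha' hb hb' hA.symm hB hC
  · rw [mix_rotate, mix_rotate]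
    exact same_bc ha'' ha ha' hB hC

lemma sliceSigns_mix
    (ha : ∀ i, 0 ≤ a i) (ha' : ∀ i, 0 ≤ a' i) (ha'' : ∀ i, 0 ≤ a'' i)
    (hb : ∀ i, 0 ≤ b i) (hb' : ∀ i, 0 ≤ b' i) (hb'' : ∀ i, 0 ≤ b'' i)
    (hc : ∀ i, 0 ≤ c i) (hc' : ∀ i, 0 ≤ c' i) (hc'' : ∀ i, 0 ≤ c'' i) :
    SliceSigns (mix a a' a'' b b' b'' c c' c'') := by
  rcases exists_mem_between ha ha' ha'' with h | h | h
  · exact sliceSigns_mix_of_between ha ha' ha'' hb hb' hb'' hc hc' hc'' h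
  · rw [mix_swap]
    exact sliceSigns_mix_of_between ha' ha ha'' hb' hb hb'' hc' hc hc'' h
  · rw [mix_rotate, mix_rotate]
    exact sliceSigns_mix_of_between ha'' ha ha' hb'' hb hb' hc'' hc hc' h

end Mix

lemma inM33.sliceSigns {p : Tensor} (hp : inM33 p) : SliceSigns p := by
  obtain ⟨-, q, r, s, ⟨a, b, c, ha, hb, hc, hq⟩, ⟨a', b', c', ha', hb', hc', hr⟩,
    ⟨a'', b'', c'', ha'', hb'', hc'', hs⟩, h⟩ := hp
  have key := sliceSigns_mix ha ha' ha'' hb hb' hb'' hc hc' hc''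
  have e : p = mix a a' a'' b b' b'' c c' c'' := by
    funext i j k
    simp only [mix, h, hq, hr, hs]
  rwa [← e] at key

/-! ### Tensors in the union of the six semialgebraic sets lie in both models -/

lemma exists_corner_add_rankOne {A : Fin 2 → Fin 2 → ℝ} (hA : ∀ j k, 0 ≤ A j k)
    (h : A 0 1 * A 1 0 ≤ A 0 0 * A 1 1) :
    ∃ (x : ℝ) (b c : Fin 2 → ℝ), 0 ≤ x ∧ (∀ j, 0 ≤ b j) ∧ (∀ k, 0 ≤ c k) ∧
      ∀ j k, A j k = x * ![1, 0] j * ![1, 0] k + b j * c k := by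
  have h00 := hA 0 0
  have h01 := hA 0 1
  have h10 := hA 1 0
  rcases (hA 1 1).eq_or_lt with h11 | h11
  · have : A 0 1 * A 1 0 = 0 := le_antisymm (by simpa [← h11] using h) (mul_nonneg h01 h10)
    rcases mul_eq_zero.1 this with h0 | h0
    · refine ⟨0, ![A 0 0, A 1 0], ![1, 0], le_rfl, ?_, ?_, ?_⟩ <;>
        simp [Fin.forall_fin_two, h00, h10, h0, ← h11]
    · refine ⟨0, ![1, 0], ![A 0 0, A 0 1], le_rfl, ?_, ?_, ?_⟩ <;>
        simp [Fin.forall_fin_two, h00, h01, h0, ← h11]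
  · refine ⟨A 0 0 - A 0 1 * A 1 0 / A 1 1, ![A 0 1 / A 1 1, 1], ![A 1 0, A 1 1], ?_, ?_, ?_, ?_⟩
    · rw [sub_nonneg, div_le_iff₀ h11]
      exact h
    · simp [Fin.forall_fin_two, div_nonneg h01 h11.le]
    · simp [Fin.forall_fin_two, h10, h11.le]
    · simp only [Fin.forall_fin_two, Matrix.cons_val_zero, Matrix.cons_val_one]
      refine ⟨⟨?_, ?_⟩, ?_, ?_⟩ <;> field_simp <;> ring

/-- The tensor whose slices in the first direction are `x 0 • u ⊗ v + b ⊗ c` and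
`x 1 • u ⊗ v + b' ⊗ c'`. -/
def sliceMix (x u v b c b' c' : Fin 2 → ℝ) : Tensor :=
  mix x ![1, 0] ![0, 1] u b b' v c c'

lemma exists_eq_sliceMix_of_C1 {p : Tensor} (hp : ∀ i j k, 0 ≤ p i j k) (h : C1 p) :
    ∃ x b c b' c' : Fin 2 → ℝ, (∀ i, 0 ≤ x i) ∧ (∀ i, 0 ≤ b i) ∧ (∀ i, 0 ≤ c i) ∧
      (∀ i, 0 ≤ b' i) ∧ (∀ i, 0 ≤ c' i) ∧ p = sliceMix x ![1, 0] ![1, 0] b c b' c' := by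
  obtain ⟨x, b, c, hx, hb, hc, e⟩ := exists_corner_add_rankOne (hp 0) h.1
  obtain ⟨x', b', c', hx', hb', hc', e'⟩ := exists_corner_add_rankOne (hp 1) h.2
  refine ⟨![x, x'], b, c, b', c', ?_, hb, hc, hb', hc', ?_⟩
  · simp [Fin.forall_fin_two, hx, hx']
  · funext i j k
    fin_cases i
    · simp [sliceMix, mix, e]
    · simp [sliceMix, mix, e']

lemma exists_eq_sliceMix {p : Tensor} (hp : ∀ i j k, 0 ≤ p i j k) (h : C1 p ∨ C2 p) :
    ∃ x u v b c b' c' : Fin 2 → ℝ, (∀ i, 0 ≤ x i) ∧ (∀ i, 0 ≤ u i) ∧ (∀ i, 0 ≤ v i) ∧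
      (∀ i, 0 ≤ b i) ∧ (∀ i, 0 ≤ c i) ∧ (∀ i, 0 ≤ b' i) ∧ (∀ i, 0 ≤ c' i) ∧
      p = sliceMix x u v b c b' c' := by
  have hu : ∀ i, 0 ≤ (![1, 0] : Fin 2 → ℝ) i := by simp [Fin.forall_fin_two]
  rcases h with h | h
  · obtain ⟨x, b, c, b', c', hx, hb, hc, hb', hc', e⟩ := exists_eq_sliceMix_of_C1 hp h
    exact ⟨x, _, _, b, c, b', c', hx, hu, hu, hb, hc, hb', hc', e⟩
  · obtain ⟨x, b, c, b', c', hx, hb, hc, hb', hc', e⟩ :=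
      exists_eq_sliceMix_of_C1 (p := fun i j k => p i j k.rev) (fun i j k => hp i j k.rev) h
    refine ⟨x, _, fun k => ![1, 0] k.rev, b, fun k => c k.rev, b', fun k => c' k.rev, hx, hu,
      fun k => hu k.rev, hb, fun k => hc k.rev, hb', fun k => hc' k.rev, ?_⟩
    funext i j k
    have := congrFun (congrFun (congrFun e i) j) k.rev
    simpa [sliceMix, mix] using this

section SliceMix

variable {x u v b c b' c' : Fin 2 → ℝ}

lemma inM33_sliceMix (hx : ∀ i, 0 ≤ x i) (hu : ∀ i, 0 ≤ u i) (hv : ∀ i, 0 ≤ v i)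
    (hb : ∀ i, 0 ≤ b i) (hc : ∀ i, 0 ≤ c i) (hb' : ∀ i, 0 ≤ b' i) (hc' : ∀ i, 0 ≤ c' i)
    (hd : isDist (sliceMix x u v b c b' c')) : inM33 (sliceMix x u v b c b' c') :=
  ⟨hd, _, _, _, ⟨x, u, v, hx, hu, hv, fun _ _ _ => rfl⟩,
    ⟨![1, 0], b, c, by simp [Fin.forall_fin_two], hb, hc, fun _ _ _ => rfl⟩,
    ⟨![0, 1], b', c', by simp [Fin.forall_fin_two], hb', hc', fun _ _ _ => rfl⟩,
    fun _ _ _ => rfl⟩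

/-- The sum of all entries of a tensor. -/
def total (p : Tensor) : ℝ := ∑ i, ∑ j, ∑ k, p i j k

lemma inRBM32_smul_sliceMix (hx : ∀ i, 0 < x i) (hu : ∀ i, 0 < u i) (hv : ∀ i, 0 < v i)
    (hb : ∀ i, 0 ≤ b i) (hc : ∀ i, 0 ≤ c i) (hb' : ∀ i, 0 ≤ b' i) (hc' : ∀ i, 0 ≤ c' i)
    {y : ℝ} (hy : 0 ≤ y) (hd : y * total (sliceMix x u v b c b' c') = 1) :
    inRBM32 (y • sliceMix x u v b c b' c') := by
  have e0 : ∀ i, 0 ≤ (![1, 0] : Fin 2 → ℝ) i := by simp [Fin.forall_fin_two]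
  have e1 : ∀ i, 0 ≤ (![0, 1] : Fin 2 → ℝ) i := by simp [Fin.forall_fin_two]
  refine ⟨⟨fun i j k => ?_, ?_⟩, fun i j k => y * x i * u j * v k,
    fun i j k => y * ![1, 0] i * b j * c k, fun _ _ _ => 1 * 1 * 1,
    fun i j k => ![0, 1] i / x i * (b' j / u j) * (c' k / v k),
    ⟨fun i => y * x i, u, v, fun i => mul_nonneg hy (hx i).le, fun i => (hu i).le,
      fun i => (hv i).le, fun _ _ _ => rfl⟩,
    ⟨fun i => y * ![1, 0] i, b, c, fun i => mul_nonneg hy (e0 i), hb, hc, fun _ _ _ => rfl⟩,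
    ⟨1, 1, 1, fun _ => zero_le_one, fun _ => zero_le_one, fun _ => zero_le_one,
      fun _ _ _ => rfl⟩,
    ⟨fun i => ![0, 1] i / x i, fun j => b' j / u j, fun k => c' k / v k,
      fun i => div_nonneg (e1 i) (hx i).le, fun i => div_nonneg (hb' i) (hu i).le,
      fun i => div_nonneg (hc' i) (hv i).le, fun _ _ _ => rfl⟩, fun i j k => ?_⟩
  · have := hx i; have := hu j; have := hv k; have := hb j; have := hc k
    have := hb' j; have := hc' k; have := e0 i; have := e1 i
    simp only [Pi.smul_apply, smul_eq_mul, sliceMix, mix]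
    positivity
  · rw [← hd, total]
    simp only [Pi.smul_apply, smul_eq_mul, Finset.mul_sum]
  · have := (hx i).ne'
    have := (hu j).ne'
    have := (hv k).ne'
    fin_cases i <;> simp [sliceMix, mix] <;> simp at this <;> field_simp

lemma sliceMix_mem_closure (hx : ∀ i, 0 ≤ x i) (hu : ∀ i, 0 ≤ u i) (hv : ∀ i, 0 ≤ v i)
    (hb : ∀ i, 0 ≤ b i) (hc : ∀ i, 0 ≤ c i) (hb' : ∀ i, 0 ≤ b' i) (hc' : ∀ i, 0 ≤ c' i)
    (hd : isDist (sliceMix x u v b c b' c')) :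
    sliceMix x u v b c b' c' ∈ closure {p : Tensor | inRBM32 p} := by
  let W : ℝ → Tensor := fun ε =>
    sliceMix (fun i => x i + ε) (fun i => u i + ε) (fun i => v i + ε) b c b' c'
  have hW : Continuous W := by
    refine continuous_pi fun i => continuous_pi fun j => continuous_pi fun k => ?_
    simp only [W, sliceMix, mix]
    fun_prop
  have hT : Continuous fun ε => total (W ε) := by
    simp only [total]
    fun_prop
  have hW0 : W 0 = sliceMix x u v b c b' c' := by simp [W]
  have hT0 : total (W 0) = 1 := by rw [hW0]; exact hd.2
  have lim : Filter.Tendsto (fun ε => (total (W ε))⁻¹ • W ε) (nhdsWithin 0 (Set.Ioi 0))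
      (nhds (sliceMix x u v b c b' c')) := by
    have := ((hT.tendsto 0).inv₀ (by rw [hT0]; exact one_ne_zero)).smul (hW.tendsto 0)
    rw [hT0, inv_one, one_smul, hW0] at this
    exact this.mono_left nhdsWithin_le_nhds
  refine mem_closure_of_tendsto lim ?_
  have hpos : ∀ᶠ ε in nhdsWithin (0 : ℝ) (Set.Ioi 0), 0 < total (W ε) :=
    ((hT.tendsto 0).mono_left nhdsWithin_le_nhds).eventually
      (lt_mem_nhds (by rw [hT0]; exact one_pos))
  filter_upwards [self_mem_nhdsWithin, hpos] with ε hε hTε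
  exact inRBM32_smul_sliceMix (fun i => add_pos_of_nonneg_of_pos (hx i) hε)
    (fun i => add_pos_of_nonneg_of_pos (hu i) hε) (fun i => add_pos_of_nonneg_of_pos (hv i) hε)
    hb hc hb' hc' (inv_nonneg.2 hTε.le) (inv_mul_cancel₀ hTε.ne')

end SliceMix

/-- Exchange of the first two directions. -/
def swapFst (p : Tensor) : Tensor := fun i j k => p j i k

/-- Reversal of the three directions. -/
def revDirs (p : Tensor) : Tensor := fun i j k => p k j i

lemma rankOne.swapFst {p : Tensor} (h : rankOne p) : rankOne (swapFst p) := by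
  obtain ⟨a, b, c, ha, hb, hc, h⟩ := h
  exact ⟨b, a, c, hb, ha, hc, fun i j k => by simp only [_root_.swapFst, h]; ring⟩

lemma rankOne.revDirs {p : Tensor} (h : rankOne p) : rankOne (revDirs p) := by
  obtain ⟨a, b, c, ha, hb, hc, h⟩ := h
  exact ⟨c, b, a, hc, hb, ha, fun i j k => by simp only [_root_.revDirs, h]; ring⟩

lemma isDist.swapFst {p : Tensor} (h : isDist p) : isDist (swapFst p) := by
  refine ⟨fun i j k => h.1 j i k, ?_⟩
  rw [← h.2]
  exact Finset.sum_comm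

lemma isDist.revDirs {p : Tensor} (h : isDist p) : isDist (revDirs p) := by
  refine ⟨fun i j k => h.1 k j i, ?_⟩
  rw [← h.2]
  simp only [_root_.revDirs, Fin.sum_univ_two]
  ring

lemma inM33.swapFst {p : Tensor} (h : inM33 p) : inM33 (swapFst p) := by
  obtain ⟨hp, q, r, s, hq, hr, hs, h⟩ := h
  exact ⟨hp.swapFst, _, _, _, hq.swapFst, hr.swapFst, hs.swapFst, fun i j k => h j i k⟩

lemma inM33.revDirs {p : Tensor} (h : inM33 p) : inM33 (revDirs p) := by
  obtain ⟨hp, q, r, s, hq, hr, hs, h⟩ := h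
  exact ⟨hp.revDirs, _, _, _, hq.revDirs, hr.revDirs, hs.revDirs, fun i j k => h k j i⟩

lemma inRBM32.swapFst {p : Tensor} (h : inRBM32 p) : inRBM32 (swapFst p) := by
  obtain ⟨hp, q, r, s, t, hq, hr, hs, ht, h⟩ := h
  exact ⟨hp.swapFst, _, _, _, _, hq.swapFst, hr.swapFst, hs.swapFst, ht.swapFst,
    fun i j k => h j i k⟩

lemma inRBM32.revDirs {p : Tensor} (h : inRBM32 p) : inRBM32 (revDirs p) := by
  obtain ⟨hp, q, r, s, t, hq, hr, hs, ht, h⟩ := h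
  exact ⟨hp.revDirs, _, _, _, _, hq.revDirs, hr.revDirs, hs.revDirs, ht.revDirs,
    fun i j k => h k j i⟩

lemma continuous_swapFst : Continuous swapFst := by
  unfold swapFst
  fun_prop

lemma continuous_revDirs : Continuous revDirs := by
  unfold revDirs
  fun_prop

lemma mem_both_of_C1_or_C2 {p : Tensor} (hp : isDist p) (h : C1 p ∨ C2 p) :
    inM33 p ∧ p ∈ closure {p : Tensor | inRBM32 p} := by
  obtain ⟨x, u, v, b, c, b', c', hx, hu, hv, hb, hc, hb', hc', rfl⟩ := exists_eq_sliceMix hp.1 h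
  exact ⟨inM33_sliceMix hx hu hv hb hc hb' hc' hp, sliceMix_mem_closure hx hu hv hb hc hb' hc' hp⟩

lemma SliceSigns.mem_both {p : Tensor} (h : SliceSigns p) (hp : isDist p) :
    inM33 p ∧ p ∈ closure {p : Tensor | inRBM32 p} := by
  have swap (h : C1 (swapFst p) ∨ C2 (swapFst p)) :
      inM33 p ∧ p ∈ closure {p : Tensor | inRBM32 p} := by
    obtain ⟨h1, h2⟩ := mem_both_of_C1_or_C2 hp.swapFst h
    exact ⟨h1.swapFst, map_mem_closure continuous_swapFst h2 fun _ => inRBM32.swapFst⟩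
  have rev (h : C1 (revDirs p) ∨ C2 (revDirs p)) :
      inM33 p ∧ p ∈ closure {p : Tensor | inRBM32 p} := by
    obtain ⟨h1, h2⟩ := mem_both_of_C1_or_C2 hp.revDirs h
    exact ⟨h1.revDirs, map_mem_closure continuous_revDirs h2 fun _ => inRBM32.revDirs⟩
  rcases h with h | h | h | h | h | h
  · exact mem_both_of_C1_or_C2 hp (.inl h)
  · exact mem_both_of_C1_or_C2 hp (.inr h)
  · exact swap (.inl h)
  · exact swap (.inr h)
  · refine rev (.inl ?_)
    simp only [C1, C5, revDirs, ge_iff_le] at h ⊢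
    constructor <;> linarith
  · refine rev (.inr ?_)
    simp only [C2, C6, revDirs] at h ⊢
    constructor <;> linarith

theorem stmt2 : {p : Tensor | inM33 p} = closure {p : Tensor | inRBM32 p} := by
  refine Set.Subset.antisymm (fun p hp => (hp.sliceSigns.mem_both hp.1).2) fun p hp => ?_
  obtain ⟨hd, hs⟩ := closure_setOf_inRBM32_subset hp
  exact (hs.mem_both hd).1
end

section
/- A strictly positive probability distribution p ∈ Δ7 belongs to M_{3,3} if and only if it belongs to RBM_{3,2}; that is, the two models coincide on the interior of the simplex. -/
open Real

/-- `p` is a sum of three nonnegative rank-one tensors. -/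
def IsMixture (p : Tensor) : Prop :=
  ∃ q r s : Tensor, rankOne q ∧ rankOne r ∧ rankOne s ∧
    ∀ i j k, p i j k = q i j k + r i j k + s i j k

/-- `p` is an entrywise product of two sums of two nonnegative rank-one tensors. -/
def IsProduct (p : Tensor) : Prop :=
  ∃ q r s t : Tensor, rankOne q ∧ rankOne r ∧ rankOne s ∧ rankOne t ∧
    ∀ i j k, p i j k = (q i j k + r i j k) * (s i j k + t i j k)

/-- Some pair of opposite faces of `p` has determinants of weakly equal signs. -/
def HasAlignedFaces (p : Tensor) : Prop :=
  C1 p ∨ C2 p ∨ C3 p ∨ C4 p ∨ C5 p ∨ C6 p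

/-! ### Symmetries of the cube -/

lemma rankOne.swap12 {q : Tensor} (h : rankOne q) : rankOne (fun i j k => q j i k) := by
  obtain ⟨a, b, c, ha, hb, hc, h⟩ := h
  exact ⟨b, a, c, hb, ha, hc, fun i j k => by simp only [h]; ring⟩

lemma rankOne.swap13 {q : Tensor} (h : rankOne q) : rankOne (fun i j k => q k j i) := by
  obtain ⟨a, b, c, ha, hb, hc, h⟩ := h
  exact ⟨c, b, a, hc, hb, ha, fun i j k => by simp only [h]; ring⟩

lemma rankOne.rev3 {q : Tensor} (h : rankOne q) : rankOne (fun i j k => q i j k.rev) := by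
  obtain ⟨a, b, c, ha, hb, hc, h⟩ := h
  exact ⟨a, b, fun k => c k.rev, ha, hb, fun k => hc _, fun i j k => by simp only [h]⟩

lemma IsMixture.swap12 {p : Tensor} (h : IsMixture fun i j k => p j i k) : IsMixture p := by
  obtain ⟨q, r, s, hq, hr, hs, h⟩ := h
  exact ⟨_, _, _, hq.swap12, hr.swap12, hs.swap12, fun i j k => h j i k⟩

lemma IsMixture.swap13 {p : Tensor} (h : IsMixture fun i j k => p k j i) : IsMixture p := by
  obtain ⟨q, r, s, hq, hr, hs, h⟩ := h
  exact ⟨_, _, _, hq.swap13, hr.swap13, hs.swap13, fun i j k => h k j i⟩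

lemma IsMixture.rev3 {p : Tensor} (h : IsMixture fun i j k => p i j k.rev) : IsMixture p := by
  obtain ⟨q, r, s, hq, hr, hs, h⟩ := h
  exact ⟨_, _, _, hq.rev3, hr.rev3, hs.rev3, fun i j k => by simpa using h i j k.rev⟩

lemma IsProduct.swap12 {p : Tensor} (h : IsProduct fun i j k => p j i k) : IsProduct p := by
  obtain ⟨q, r, s, t, hq, hr, hs, ht, h⟩ := h
  exact ⟨_, _, _, _, hq.swap12, hr.swap12, hs.swap12, ht.swap12, fun i j k => h j i k⟩

lemma IsProduct.swap13 {p : Tensor} (h : IsProduct fun i j k => p k j i) : IsProduct p := by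
  obtain ⟨q, r, s, t, hq, hr, hs, ht, h⟩ := h
  exact ⟨_, _, _, _, hq.swap13, hr.swap13, hs.swap13, ht.swap13, fun i j k => h k j i⟩

lemma IsProduct.rev3 {p : Tensor} (h : IsProduct fun i j k => p i j k.rev) : IsProduct p := by
  obtain ⟨q, r, s, t, hq, hr, hs, ht, h⟩ := h
  exact ⟨_, _, _, _, hq.rev3, hr.rev3, hs.rev3, ht.rev3,
    fun i j k => by simpa using h i j k.rev⟩

lemma HasAlignedFaces.rev1 {p : Tensor} (h : HasAlignedFaces fun i j k => p i.rev j k) :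
    HasAlignedFaces p := by
  simp only [HasAlignedFaces, C1, C2, C3, C4, C5, C6, Fin.isValue,
    show Fin.rev (0 : Fin 2) = 1 from rfl, show Fin.rev (1 : Fin 2) = 0 from rfl] at h ⊢
  grind

lemma HasAlignedFaces.rev2 {p : Tensor} (h : HasAlignedFaces fun i j k => p i j.rev k) :
    HasAlignedFaces p := by
  simp only [HasAlignedFaces, C1, C2, C3, C4, C5, C6, Fin.isValue,
    show Fin.rev (0 : Fin 2) = 1 from rfl, show Fin.rev (1 : Fin 2) = 0 from rfl] at h ⊢
  grind

lemma HasAlignedFaces.rev3 {p : Tensor} (h : HasAlignedFaces fun i j k => p i j k.rev) :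
    HasAlignedFaces p := by
  simp only [HasAlignedFaces, C1, C2, C3, C4, C5, C6, Fin.isValue,
    show Fin.rev (0 : Fin 2) = 1 from rfl, show Fin.rev (1 : Fin 2) = 0 from rfl] at h ⊢
  grind

/-! ### Aligned faces give both decompositions -/

lemma isMixture_and_isProduct_of_C1 {p : Tensor} (hpos : ∀ i j k, 0 < p i j k) (h : C1 p) :
    IsMixture p ∧ IsProduct p := by
  have hα : ∀ i, 0 ≤ p i 0 0 - p i 0 1 * p i 1 0 / p i 1 1 := by
    intro i
    rw [sub_nonneg, div_le_iff₀ (hpos _ _ _)]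
    fin_cases i
    exacts [h.1, h.2]
  have hq (l : Fin 2) : rankOne fun i j k =>
      (if i = l then 1 else 0) * p l j 1 * (p l 1 k / p l 1 1) :=
    ⟨_, _, _, fun i => by positivity, fun j => (hpos _ _ _).le,
      fun k => (div_pos (hpos _ _ _) (hpos _ _ _)).le, fun _ _ _ => rfl⟩
  have hδ : ∀ j : Fin 2, (0 : ℝ) ≤ if j = 0 then 1 else 0 := fun j => by positivity
  have hne : ∀ i j k, p i j k ≠ 0 := fun i j k => (hpos i j k).ne'
  constructor
  · refine ⟨_, _, _, hq 0, hq 1, ⟨_, _, _, hα, hδ, hδ, fun _ _ _ => rfl⟩, ?_⟩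
    intro i j k
    have := hne i 1 1
    fin_cases i <;> fin_cases j <;> fin_cases k <;> simp at this ⊢ <;> field_simp <;> ring
  · refine ⟨_, _, fun _ _ _ => 1, _, hq 0, hq 1,
      ⟨fun _ => 1, fun _ => 1, fun _ => 1, by simp, by simp, by simp, by simp⟩,
      ⟨fun i => (p i 0 0 - p i 0 1 * p i 1 0 / p i 1 1) / (p i 0 1 * p i 1 0 / p i 1 1), _, _,
        fun i => div_nonneg (hα i) (div_pos (mul_pos (hpos _ _ _) (hpos _ _ _)) (hpos _ _ _)).le,
        hδ, hδ, fun _ _ _ => rfl⟩, ?_⟩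
    intro i j k
    have h1 := hne i 1 1
    have h2 := hne i 0 1
    have h3 := hne i 1 0
    fin_cases i <;> fin_cases j <;> fin_cases k <;> simp at h1 h2 h3 ⊢ <;> field_simp <;> ring

lemma isMixture_and_isProduct_of_C1_or_C2 {p : Tensor} (hpos : ∀ i j k, 0 < p i j k)
    (h : C1 p ∨ C2 p) : IsMixture p ∧ IsProduct p := by
  rcases h with h | h
  · exact isMixture_and_isProduct_of_C1 hpos h
  · have := isMixture_and_isProduct_of_C1 (p := fun i j k => p i j k.rev)
      (fun i j k => hpos _ _ _) h
    exact ⟨this.1.rev3, this.2.rev3⟩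

lemma HasAlignedFaces.isMixture_and_isProduct {p : Tensor} (h : HasAlignedFaces p)
    (hpos : ∀ i j k, 0 < p i j k) : IsMixture p ∧ IsProduct p := by
  have h12 := isMixture_and_isProduct_of_C1_or_C2 (p := fun i j k => p j i k)
    (fun i j k => hpos _ _ _)
  have h13 := isMixture_and_isProduct_of_C1_or_C2 (p := fun i j k => p k j i)
    (fun i j k => hpos _ _ _)
  rcases h with h | h | h | h | h | h
  · exact isMixture_and_isProduct_of_C1_or_C2 hpos (.inl h)
  · exact isMixture_and_isProduct_of_C1_or_C2 hpos (.inr h)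
  · have := h12 (.inl h)
    exact ⟨this.1.swap12, this.2.swap12⟩
  · have := h12 (.inr h)
    exact ⟨this.1.swap12, this.2.swap12⟩
  · have := h13 (.inl ⟨by linarith [h.1], by linarith [h.2]⟩)
    exact ⟨this.1.swap13, this.2.swap13⟩
  · have := h13 (.inr ⟨by linarith [h.1], by linarith [h.2]⟩)
    exact ⟨this.1.swap13, this.2.swap13⟩

/-! ### Products have aligned faces -/

lemma sign_pattern_of_rankOne_add {q r : Tensor} (hq : rankOne q) (hr : rankOne r) {m : Tensor}
    (hm : ∀ i j k, m i j k = q i j k + r i j k) :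
    (∀ i j k, 0 ≤ m i j k) ∧
    (C1 m ∧ C3 m ∧ C5 m ∨ C1 m ∧ C4 m ∧ C6 m ∨ C2 m ∧ C3 m ∧ C6 m ∨ C2 m ∧ C4 m ∧ C5 m) := by
  obtain ⟨a, b, c, ha, hb, hc, hq⟩ := hq
  obtain ⟨a', b', c', ha', hb', hc', hr⟩ := hr
  simp only [hq, hr] at hm
  refine ⟨fun i j k => ?_, ?_⟩
  · rw [hm]
    have := ha i; have := hb j; have := hc k
    have := ha' i; have := hb' j; have := hc' k
    positivity
  have face1 (i : Fin 2) : m i 0 0 * m i 1 1 - m i 0 1 * m i 1 0 =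
      (a i * a' i) * ((b 1 * b' 0 - b 0 * b' 1) * (c 1 * c' 0 - c 0 * c' 1)) := by
    simp only [hm]; ring
  have face2 (j : Fin 2) : m 0 j 0 * m 1 j 1 - m 0 j 1 * m 1 j 0 =
      (b j * b' j) * ((a 1 * a' 0 - a 0 * a' 1) * (c 1 * c' 0 - c 0 * c' 1)) := by
    simp only [hm]; ring
  have face3 (k : Fin 2) : m 0 0 k * m 1 1 k - m 1 0 k * m 0 1 k =
      (c k * c' k) * ((a 1 * a' 0 - a 0 * a' 1) * (b 1 * b' 0 - b 0 * b' 1)) := by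
    simp only [hm]; ring
  generalize a 1 * a' 0 - a 0 * a' 1 = x at *
  generalize b 1 * b' 0 - b 0 * b' 1 = y at *
  generalize c 1 * c' 0 - c 0 * c' 1 = z at *
  have hA i := mul_nonneg (ha i) (ha' i)
  have hB i := mul_nonneg (hb i) (hb' i)
  have hC i := mul_nonneg (hc i) (hc' i)
  have p1 (h : 0 ≤ y * z) : C1 m :=
    ⟨by linarith [face1 0, mul_nonneg (hA 0) h], by linarith [face1 1, mul_nonneg (hA 1) h]⟩
  have n1 (h : y * z ≤ 0) : C2 m :=
    ⟨by linarith [face1 0, mul_nonpos_of_nonneg_of_nonpos (hA 0) h],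
      by linarith [face1 1, mul_nonpos_of_nonneg_of_nonpos (hA 1) h]⟩
  have p2 (h : 0 ≤ x * z) : C3 m :=
    ⟨by linarith [face2 0, mul_nonneg (hB 0) h], by linarith [face2 1, mul_nonneg (hB 1) h]⟩
  have n2 (h : x * z ≤ 0) : C4 m :=
    ⟨by linarith [face2 0, mul_nonpos_of_nonneg_of_nonpos (hB 0) h],
      by linarith [face2 1, mul_nonpos_of_nonneg_of_nonpos (hB 1) h]⟩
  have p3 (h : 0 ≤ x * y) : C5 m :=
    ⟨by linarith [face3 0, mul_nonneg (hC 0) h], by linarith [face3 1, mul_nonneg (hC 1) h]⟩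
  have n3 (h : x * y ≤ 0) : C6 m :=
    ⟨by linarith [face3 0, mul_nonpos_of_nonneg_of_nonpos (hC 0) h],
      by linarith [face3 1, mul_nonpos_of_nonneg_of_nonpos (hC 1) h]⟩
  have pp {s t : ℝ} (hs : 0 ≤ s) (ht : 0 ≤ t) : 0 ≤ s * t := mul_nonneg hs ht
  have nn {s t : ℝ} (hs : s ≤ 0) (ht : t ≤ 0) : 0 ≤ s * t := mul_nonneg_of_nonpos_of_nonpos hs ht
  have pn {s t : ℝ} (hs : 0 ≤ s) (ht : t ≤ 0) : s * t ≤ 0 := mul_nonpos_of_nonneg_of_nonpos hs ht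
  have np {s t : ℝ} (hs : s ≤ 0) (ht : 0 ≤ t) : s * t ≤ 0 := mul_nonpos_of_nonpos_of_nonneg hs ht
  rcases le_total 0 x with hx | hx <;> rcases le_total 0 y with hy | hy <;>
    rcases le_total 0 z with hz | hz <;> grind

lemma IsProduct.hasAlignedFaces {p : Tensor} (h : IsProduct p) : HasAlignedFaces p := by
  obtain ⟨q, r, s, t, hq, hr, hs, ht, h⟩ := h
  obtain ⟨m, hm⟩ : ∃ m : Tensor, ∀ i j k, m i j k = q i j k + r i j k := ⟨_, fun _ _ _ => rfl⟩
  obtain ⟨n, hn⟩ : ∃ n : Tensor, ∀ i j k, n i j k = s i j k + t i j k := ⟨_, fun _ _ _ => rfl⟩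
  simp only [← hm, ← hn] at h
  obtain ⟨m0, Hm⟩ := sign_pattern_of_rankOne_add hq hr hm
  obtain ⟨n0, Hn⟩ := sign_pattern_of_rankOne_add hs ht hn
  have key {x y z w x' y' z' w' : ℝ} (hx : 0 ≤ x) (hy : 0 ≤ y) (hx' : 0 ≤ x') (hy' : 0 ≤ y')
      (h : x * y ≤ z * w) (h' : x' * y' ≤ z' * w') : (x * x') * (y * y') ≤ (z * z') * (w * w') := by
    have := mul_le_mul h h' (mul_nonneg hx' hy') ((mul_nonneg hx hy).trans h)
    linarith
  have k1 (h1 : C1 m) (h2 : C1 n) : C1 p := by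
    simp only [C1, h]
    exact ⟨key (m0 ..) (m0 ..) (n0 ..) (n0 ..) h1.1 h2.1,
      key (m0 ..) (m0 ..) (n0 ..) (n0 ..) h1.2 h2.2⟩
  have k2 (h1 : C2 m) (h2 : C2 n) : C2 p := by
    simp only [C2, h]
    exact ⟨key (m0 ..) (m0 ..) (n0 ..) (n0 ..) h1.1 h2.1,
      key (m0 ..) (m0 ..) (n0 ..) (n0 ..) h1.2 h2.2⟩
  have k3 (h1 : C3 m) (h2 : C3 n) : C3 p := by
    simp only [C3, h]
    exact ⟨key (m0 ..) (m0 ..) (n0 ..) (n0 ..) h1.1 h2.1,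
      key (m0 ..) (m0 ..) (n0 ..) (n0 ..) h1.2 h2.2⟩
  have k4 (h1 : C4 m) (h2 : C4 n) : C4 p := by
    simp only [C4, h]
    exact ⟨key (m0 ..) (m0 ..) (n0 ..) (n0 ..) h1.1 h2.1,
      key (m0 ..) (m0 ..) (n0 ..) (n0 ..) h1.2 h2.2⟩
  have k5 (h1 : C5 m) (h2 : C5 n) : C5 p := by
    simp only [C5, h]
    exact ⟨key (m0 ..) (m0 ..) (n0 ..) (n0 ..) h1.1 h2.1,
      key (m0 ..) (m0 ..) (n0 ..) (n0 ..) h1.2 h2.2⟩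
  have k6 (h1 : C6 m) (h2 : C6 n) : C6 p := by
    simp only [C6, h]
    exact ⟨key (m0 ..) (m0 ..) (n0 ..) (n0 ..) h1.1 h2.1,
      key (m0 ..) (m0 ..) (n0 ..) (n0 ..) h1.2 h2.2⟩
  clear hm hn h m0 n0 key
  unfold HasAlignedFaces
  rcases Hm with ⟨a, b, c⟩ | ⟨a, b, c⟩ | ⟨a, b, c⟩ | ⟨a, b, c⟩ <;>
    rcases Hn with ⟨a', b', c'⟩ | ⟨a', b', c'⟩ | ⟨a', b', c'⟩ | ⟨a', b', c'⟩ <;>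
    simp only [*, true_or, or_true]

/-! ### Mixtures have aligned faces -/

/-- The determinant of a pair of plane vectors, positive when the first has the larger slope. -/
def bracket (u v : Fin 2 → ℝ) : ℝ := u 1 * v 0 - u 0 * v 1

/-- The tensor `∑ l, a l ⊗ b l ⊗ c l` with three summands. -/
def mixture (a b c : Fin 3 → Fin 2 → ℝ) : Tensor := fun i j k =>
  a 0 i * b 0 j * c 0 k + a 1 i * b 1 j * c 1 k + a 2 i * b 2 j * c 2 k

/-- The determinant of `∑ l, w l • (b l ⊗ c l)`, by the Cauchy–Binet expansion. -/
def faceDet (w : Fin 3 → ℝ) (b c : Fin 3 → Fin 2 → ℝ) : ℝ :=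
  w 0 * w 1 * (bracket (b 0) (b 1) * bracket (c 0) (c 1)) +
  w 0 * w 2 * (bracket (b 0) (b 2) * bracket (c 0) (c 2)) +
  w 1 * w 2 * (bracket (b 1) (b 2) * bracket (c 1) (c 2))

lemma faceDet_comm (w : Fin 3 → ℝ) (b c : Fin 3 → Fin 2 → ℝ) :
    faceDet w b c = faceDet w c b := by
  simp only [faceDet]; ring

lemma mul_bracket (u v w : Fin 2 → ℝ) (i : Fin 2) :
    v i * bracket u w = u i * bracket v w + w i * bracket u v := by
  fin_cases i <;> simp [bracket] <;> ring

lemma bracket_rev (u v : Fin 2 → ℝ) :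
    bracket (fun i => u i.rev) (fun i => v i.rev) = -bracket u v := by
  simp only [bracket, show Fin.rev (0 : Fin 2) = 1 from rfl, show Fin.rev (1 : Fin 2) = 0 from rfl]
  ring

lemma bracket_nonpos_of_neg {u v w : Fin 2 → ℝ} (hu : ∀ i, 0 ≤ u i) (hv : ∀ i, 0 ≤ v i)
    (hw : ∀ i, 0 ≤ w i) (huv : 0 ≤ bracket u v) (h : bracket u w < 0) : bracket v w ≤ 0 := by
  by_contra! h'
  have key (i : Fin 2) : u i = 0 := by
    have e := mul_bracket u v w i
    have h1 := mul_nonpos_of_nonneg_of_nonpos (hv i) h.le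
    have h2 := mul_nonneg (hu i) h'.le
    have h3 := mul_nonneg (hw i) huv
    exact (mul_eq_zero.1 (by linarith : u i * bracket v w = 0)).resolve_right h'.ne'
  simp [bracket, key] at h

/-- With one axis of constant negative and one of constant positive orientation relative to the
last summand, two face determinants cannot both be negative. -/
lemma not_faceDet_neg_of_signs {a b c : Fin 3 → Fin 2 → ℝ}
    (ha : ∀ l i, 0 ≤ a l i) (hb : ∀ l i, 0 ≤ b l i) (i j : Fin 2)
    (hx01 : 0 ≤ bracket (a 0) (a 1)) (hy01 : 0 ≤ bracket (b 0) (b 1))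
    (hz01 : 0 ≤ bracket (c 0) (c 1))
    (hx02 : bracket (a 0) (a 2) ≤ 0) (hx12 : bracket (a 1) (a 2) ≤ 0)
    (hy02 : 0 ≤ bracket (b 0) (b 2)) (hy12 : 0 ≤ bracket (b 1) (b 2))
    (hz02 : 0 < bracket (c 0) (c 2)) (hz12 : bracket (c 1) (c 2) < 0)
    (h1 : faceDet (fun l => a l i) b c < 0) (h2 : faceDet (fun l => b l j) a c < 0) : False := by
  have hx := mul_bracket (a 0) (a 1) (a 2) i
  have hy := mul_bracket (b 0) (b 1) (b 2) j
  simp only [faceDet] at h1 h2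
  have ha0 := ha 0 i
  have ha1 := ha 1 i
  have ha2 := ha 2 i
  have hb0 := hb 0 j
  have hb1 := hb 1 j
  have hb2 := hb 2 j
  generalize a 0 i = a0 at *
  generalize a 1 i = a1 at *
  generalize a 2 i = a2 at *
  generalize b 0 j = b0 at *
  generalize b 1 j = b1 at *
  generalize b 2 j = b2 at *
  generalize bracket (a 0) (a 1) = x01 at *
  generalize bracket (a 0) (a 2) = x02 at *
  generalize bracket (a 1) (a 2) = x12 at *
  generalize bracket (b 0) (b 1) = y01 at *
  generalize bracket (b 0) (b 2) = y02 at *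
  generalize bracket (b 1) (b 2) = y12 at *
  generalize bracket (c 0) (c 1) = z01 at *
  generalize bracket (c 0) (c 2) = z02 at *
  generalize bracket (c 1) (c 2) = z12 at *
  have e1 : a2 * (a0 * y02 * z02) < a2 * (a1 * y12 * -z12) := by
    have : 0 ≤ a0 * a1 * (y01 * z01) := by positivity
    linarith
  have e2 : b2 * (b1 * -x12 * -z12) < b2 * (b0 * -x02 * z02) := by
    have : 0 ≤ b0 * b1 * (x01 * z01) := by positivity
    linarith
  have f1 := lt_of_mul_lt_mul_left e1 ha2
  have f2 := lt_of_mul_lt_mul_left e2 hb2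
  have nx : 0 ≤ -x12 := by linarith
  have nx' : 0 ≤ -x02 := by linarith
  have nz : 0 < -z12 := by linarith
  have g := mul_lt_mul'' f1 f2 (by positivity) (by positivity)
  have hz : 0 < z02 * -z12 := mul_pos hz02 nz
  have g' : (a0 * -x12) * (b1 * y02) < (a1 * -x02) * (b0 * y12) := by
    refine lt_of_mul_lt_mul_left ?_ hz.le
    linarith
  have i1 : a1 * -x02 ≤ a0 * -x12 := by nlinarith [mul_nonneg ha2 hx01]
  have i2 : b0 * y12 ≤ b1 * y02 := by nlinarith [mul_nonneg hb2 hy01]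
  exact absurd (mul_le_mul i1 i2 (by positivity) (by positivity)) (not_le.2 g')

lemma exists_neg_of_faceDet_neg {w : Fin 3 → ℝ} {b c : Fin 3 → Fin 2 → ℝ} (hw : ∀ l, 0 ≤ w l)
    (hb : 0 ≤ bracket (b 0) (b 1)) (hc : 0 ≤ bracket (c 0) (c 1)) (h : faceDet w b c < 0) :
    bracket (b 0) (b 2) * bracket (c 0) (c 2) < 0 ∨
      bracket (b 1) (b 2) * bracket (c 1) (c 2) < 0 := by
  by_contra! h'
  have h0 := mul_nonneg (mul_nonneg (hw 0) (hw 1)) (mul_nonneg hb hc)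
  have h1 := mul_nonneg (mul_nonneg (hw 0) (hw 2)) h'.1
  have h2 := mul_nonneg (mul_nonneg (hw 1) (hw 2)) h'.2
  simp only [faceDet] at h
  linarith

lemma not_faceDet_neg {a b c : Fin 3 → Fin 2 → ℝ} (ha : ∀ l i, 0 ≤ a l i)
    (hb : ∀ l i, 0 ≤ b l i) (hc : ∀ l i, 0 ≤ c l i)
    (hx : 0 ≤ bracket (a 0) (a 1)) (hy : 0 ≤ bracket (b 0) (b 1))
    (hz : 0 ≤ bracket (c 0) (c 1)) (i j k : Fin 2)
    (h1 : faceDet (fun l => a l i) b c < 0) (h2 : faceDet (fun l => b l j) a c < 0)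
    (h3 : faceDet (fun l => c l k) a b < 0) : False := by
  have sx := bracket_nonpos_of_neg (ha 0) (ha 1) (ha 2) hx
  have sy := bracket_nonpos_of_neg (hb 0) (hb 1) (hb 2) hy
  have sz := bracket_nonpos_of_neg (hc 0) (hc 1) (hc 2) hz
  have e1 := exists_neg_of_faceDet_neg (fun l => ha l i) hy hz h1
  have e2 := exists_neg_of_faceDet_neg (fun l => hb l j) hx hz h2
  have e3 := exists_neg_of_faceDet_neg (fun l => hc l k) hx hy h3
  have h1' := faceDet_comm _ b c ▸ h1
  have h2' := faceDet_comm _ a c ▸ h2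
  have h3' := faceDet_comm _ a b ▸ h3
  have xy := fun p q r s t u => not_faceDet_neg_of_signs ha hb i j hx hy hz p q r s t u h1 h2
  have yx := fun p q r s t u => not_faceDet_neg_of_signs hb ha j i hy hx hz p q r s t u h2 h1
  have xz := fun p q r s t u => not_faceDet_neg_of_signs ha hc i k hx hz hy p q r s t u h1' h3
  have zx := fun p q r s t u => not_faceDet_neg_of_signs hc ha k i hz hx hy p q r s t u h3 h1'
  have yz := fun p q r s t u => not_faceDet_neg_of_signs hb hc j k hy hz hx p q r s t u h2' h3'
  have zy := fun p q r s t u => not_faceDet_neg_of_signs hc hb k j hz hy hx p q r s t u h3' h2'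
  simp only [mul_neg_iff] at e1 e2 e3
  clear h1 h2 h3 h1' h2' h3'
  grind

/-- Strict opposite signs on all three pairs of opposite faces force the same sign at the origin. -/
lemma parity_of_not_hasAlignedFaces {p : Tensor} (hp : ∀ i j k, 0 ≤ p i j k)
    (h : ¬ HasAlignedFaces p) :
    ∃ i, p i 0 0 * p i 1 1 < p i 0 1 * p i 1 0 ∧ p 0 i 0 * p 1 i 1 < p 0 i 1 * p 1 i 0 ∧
      p 0 0 i * p 1 1 i < p 1 0 i * p 0 1 i := by
  simp only [HasAlignedFaces, C1, C2, C3, C4, C5, C6, not_or, not_and_or, not_le, ge_iff_le] at h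
  obtain ⟨h1, h2, h3, h4, h5, h6⟩ := h
  have nn (i j k i' j' k') : 0 ≤ p i j k * p i' j' k' := mul_nonneg (hp _ _ _) (hp _ _ _)
  have key {x y z w : ℝ} (hx : 0 ≤ x) (hy : 0 ≤ y) (h : x < z) (h' : y < w) : x * y < z * w :=
    mul_lt_mul'' h h' hx hy
  obtain ⟨E, hE⟩ : ∃ E, E = p 0 0 0 * p 0 1 1 * (p 1 0 1 * p 1 1 0) := ⟨_, rfl⟩
  obtain ⟨O, hO⟩ : ∃ O, O = p 0 0 1 * p 0 1 0 * (p 1 0 0 * p 1 1 1) := ⟨_, rfl⟩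
  have d1 : (p 0 0 0 * p 0 1 1 < p 0 0 1 * p 0 1 0 ∧ E < O) ∨
      (p 1 0 0 * p 1 1 1 < p 1 0 1 * p 1 1 0 ∧ O < E) := by
    rcases h1 with g | g
    · have g' := h2.resolve_left g.not_gt
      exact .inl ⟨g, by linarith [key (nn ..) (nn ..) g g']⟩
    · have g' := h2.resolve_right g.not_gt
      exact .inr ⟨g, by linarith [key (nn ..) (nn ..) g g']⟩
  have d2 : (p 0 0 0 * p 1 0 1 < p 0 0 1 * p 1 0 0 ∧ E < O) ∨
      (p 0 1 0 * p 1 1 1 < p 0 1 1 * p 1 1 0 ∧ O < E) := by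
    rcases h3 with g | g
    · have g' := h4.resolve_left g.not_gt
      exact .inl ⟨g, by linarith [key (nn ..) (nn ..) g g']⟩
    · have g' := h4.resolve_right g.not_gt
      exact .inr ⟨g, by linarith [key (nn ..) (nn ..) g g']⟩
  have d3 : (p 0 0 0 * p 1 1 0 < p 1 0 0 * p 0 1 0 ∧ E < O) ∨
      (p 0 0 1 * p 1 1 1 < p 1 0 1 * p 0 1 1 ∧ O < E) := by
    rcases h5 with g | g
    · have g' := h6.resolve_left g.not_gt
      exact .inl ⟨g, by linarith [key (nn ..) (nn ..) g g']⟩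
    · have g' := h6.resolve_right g.not_gt
      exact .inr ⟨g, by linarith [key (nn ..) (nn ..) g g']⟩
  rcases lt_or_ge E O with hEO | hEO
  · exact ⟨0, (d1.resolve_right fun h => h.2.not_gt hEO).1,
      (d2.resolve_right fun h => h.2.not_gt hEO).1, (d3.resolve_right fun h => h.2.not_gt hEO).1⟩
  · exact ⟨1, (d1.resolve_left fun h => h.2.not_ge hEO).1,
      (d2.resolve_left fun h => h.2.not_ge hEO).1, (d3.resolve_left fun h => h.2.not_ge hEO).1⟩

lemma hasAlignedFaces_mixture_of_bracket_nonneg {a b c : Fin 3 → Fin 2 → ℝ}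
    (ha : ∀ l i, 0 ≤ a l i) (hb : ∀ l i, 0 ≤ b l i) (hc : ∀ l i, 0 ≤ c l i)
    (hx : 0 ≤ bracket (a 0) (a 1)) (hy : 0 ≤ bracket (b 0) (b 1))
    (hz : 0 ≤ bracket (c 0) (c 1)) : HasAlignedFaces (mixture a b c) := by
  by_contra h
  obtain ⟨i, h1, h2, h3⟩ := parity_of_not_hasAlignedFaces (fun i j k => by
    have ha' l := ha l i
    have hb' l := hb l j
    have hc' l := hc l k
    simp only [mixture]
    have (l : Fin 3) := mul_nonneg (mul_nonneg (ha' l) (hb' l)) (hc' l)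
    linarith [this 0, this 1, this 2]) h
  refine not_faceDet_neg ha hb hc hx hy hz i i i ?_ ?_ ?_
  · refine lt_of_eq_of_lt ?_ (sub_neg.2 h1)
    simp only [faceDet, mixture, bracket]; ring
  · refine lt_of_eq_of_lt ?_ (sub_neg.2 h2)
    simp only [faceDet, mixture, bracket]; ring
  · refine lt_of_eq_of_lt ?_ (sub_neg.2 h3)
    simp only [faceDet, mixture, bracket]; ring

lemma hasAlignedFaces_mixture {a b c : Fin 3 → Fin 2 → ℝ}
    (ha : ∀ l i, 0 ≤ a l i) (hb : ∀ l i, 0 ≤ b l i) (hc : ∀ l i, 0 ≤ c l i) :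
    HasAlignedFaces (mixture a b c) := by
  wlog hx : 0 ≤ bracket (a 0) (a 1) generalizing a
  · refine HasAlignedFaces.rev1 (this (a := fun l i => a l i.rev) (fun l i => ha _ _) ?_)
    rw [bracket_rev]
    linarith
  wlog hy : 0 ≤ bracket (b 0) (b 1) generalizing b
  · refine HasAlignedFaces.rev2 (this (b := fun l i => b l i.rev) (fun l i => hb _ _) ?_)
    rw [bracket_rev]
    linarith
  wlog hz : 0 ≤ bracket (c 0) (c 1) generalizing c
  · refine HasAlignedFaces.rev3 (this (c := fun l i => c l i.rev) (fun l i => hc _ _) ?_)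
    rw [bracket_rev]
    linarith
  exact hasAlignedFaces_mixture_of_bracket_nonneg ha hb hc hx hy hz

lemma IsMixture.hasAlignedFaces {p : Tensor} (h : IsMixture p) : HasAlignedFaces p := by
  obtain ⟨q, r, s, ⟨a, b, c, ha, hb, hc, hq⟩, ⟨a', b', c', ha', hb', hc', hr⟩,
    ⟨a'', b'', c'', ha'', hb'', hc'', hs⟩, h⟩ := h
  have : p = mixture ![a, a', a''] ![b, b', b''] ![c, c', c''] := by
    funext i j k
    simp [mixture, h, hq, hr, hs]
  rw [this]
  apply hasAlignedFaces_mixture <;> intro l <;> fin_cases l <;> assumption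

theorem stmt3 (p : Tensor) (hp : isDist p) (hpos : ∀ i j k, 0 < p i j k) :
    inM33 p ↔ inRBM32 p :=
  ⟨fun h => ⟨hp, (IsMixture.hasAlignedFaces h.2 |>.isMixture_and_isProduct hpos).2⟩,
    fun h => ⟨hp, (IsProduct.hasAlignedFaces h.2 |>.isMixture_and_isProduct hpos).1⟩⟩
end

section
/- No distribution in RBM_{3,2} has four modes: for every p ∈ RBM_{3,2} there do not exist four distinct states of {0,1}³ each of which is a mode of p. -/
open Real

/-- A state of three binary random variables. -/
abbrev State : Type := Fin 2 × Fin 2 × Fin 2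

/-- Two states are Hamming neighbours if they differ in exactly one coordinate. -/
def hamNeighbour (x y : State) : Prop :=
  (x.1 ≠ y.1 ∧ x.2.1 = y.2.1 ∧ x.2.2 = y.2.2) ∨
  (x.1 = y.1 ∧ x.2.1 ≠ y.2.1 ∧ x.2.2 = y.2.2) ∨
  (x.1 = y.1 ∧ x.2.1 = y.2.1 ∧ x.2.2 ≠ y.2.2)

/-- `x` is a mode of `p` if `p` is strictly larger at `x` than at every Hamming neighbour. -/
def isMode (p : Tensor) (x : State) : Prop :=
  ∀ y : State, hamNeighbour x y → p y.1 y.2.1 y.2.2 < p x.1 x.2.1 x.2.2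

/-- The `2 × 2` minor of a two-term mixture slice factors through the minors of its factors. -/
lemma mixture_slice_minor (x x' : ℝ) (b b' c c' : Fin 2 → ℝ) :
    (x * b 0 * c 0 + x' * b' 0 * c' 0) * (x * b 1 * c 1 + x' * b' 1 * c' 1) -
      (x * b 0 * c 1 + x' * b' 0 * c' 1) * (x * b 1 * c 0 + x' * b' 1 * c' 0) =
    x * x' * ((b 0 * b' 1 - b 1 * b' 0) * (c 0 * c' 1 - c 1 * c' 0)) := by
  ring

/-- If parallel slices of a product of two mixtures have minors of opposite strict signs, then
the corresponding minors of the two mixtures have opposite strict signs. -/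
lemma mixture_minors_opposite {b b' c c' e e' f f' : Fin 2 → ℝ}
    (hb : ∀ i, 0 ≤ b i) (hb' : ∀ i, 0 ≤ b' i) (hc : ∀ i, 0 ≤ c i) (hc' : ∀ i, 0 ≤ c' i)
    (he : ∀ i, 0 ≤ e i) (he' : ∀ i, 0 ≤ e' i) (hf : ∀ i, 0 ≤ f i) (hf' : ∀ i, 0 ≤ f' i)
    {x x' y y' z z' w w' : ℝ} (hx : 0 ≤ x) (hx' : 0 ≤ x') (hy : 0 ≤ y) (hy' : 0 ≤ y')
    (hz : 0 ≤ z) (hz' : 0 ≤ z') (hw : 0 ≤ w) (hw' : 0 ≤ w')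
    (hpos : ((x * b 0 * c 1 + x' * b' 0 * c' 1) * (y * e 0 * f 1 + y' * e' 0 * f' 1)) *
        ((x * b 1 * c 0 + x' * b' 1 * c' 0) * (y * e 1 * f 0 + y' * e' 1 * f' 0)) <
      ((x * b 0 * c 0 + x' * b' 0 * c' 0) * (y * e 0 * f 0 + y' * e' 0 * f' 0)) *
        ((x * b 1 * c 1 + x' * b' 1 * c' 1) * (y * e 1 * f 1 + y' * e' 1 * f' 1)))
    (hneg : ((z * b 0 * c 0 + z' * b' 0 * c' 0) * (w * e 0 * f 0 + w' * e' 0 * f' 0)) *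
        ((z * b 1 * c 1 + z' * b' 1 * c' 1) * (w * e 1 * f 1 + w' * e' 1 * f' 1)) <
      ((z * b 0 * c 1 + z' * b' 0 * c' 1) * (w * e 0 * f 1 + w' * e' 0 * f' 1)) *
        ((z * b 1 * c 0 + z' * b' 1 * c' 0) * (w * e 1 * f 0 + w' * e' 1 * f' 0))) :
    ((b 0 * b' 1 - b 1 * b' 0) * (c 0 * c' 1 - c 1 * c' 0)) *
      ((e 0 * e' 1 - e 1 * e' 0) * (f 0 * f' 1 - f 1 * f' 0)) < 0 := by
  have nonneg : ∀ {v v' : ℝ} {g g' h h' : Fin 2 → ℝ}, 0 ≤ v → 0 ≤ v' → (∀ i, 0 ≤ g i) →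
      (∀ i, 0 ≤ g' i) → (∀ i, 0 ≤ h i) → (∀ i, 0 ≤ h' i) → ∀ i j k l,
      0 ≤ (v * g i * h j + v' * g' i * h' j) * (v * g k * h l + v' * g' k * h' l) :=
    fun hv hv' hg hg' hh hh' i j k l =>
      mul_nonneg
        (add_nonneg (mul_nonneg (mul_nonneg hv (hg i)) (hh j))
          (mul_nonneg (mul_nonneg hv' (hg' i)) (hh' j)))
        (add_nonneg (mul_nonneg (mul_nonneg hv (hg k)) (hh l))
          (mul_nonneg (mul_nonneg hv' (hg' k)) (hh' l)))
  by_contra! hcon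
  rcases mul_nonneg_iff.mp hcon with ⟨h, h'⟩ | ⟨h, h'⟩
  · refine hneg.not_ge ?_
    rw [mul_mul_mul_comm, mul_mul_mul_comm (z * b 0 * c 0 + _)]
    refine mul_le_mul ?_ ?_ (nonneg hw hw' he he' hf hf' 0 1 1 0)
      (nonneg hz hz' hb hb' hc hc' 0 0 1 1)
    · rw [← sub_nonneg, mixture_slice_minor]
      exact mul_nonneg (mul_nonneg hz hz') h
    · rw [← sub_nonneg, mixture_slice_minor]
      exact mul_nonneg (mul_nonneg hw hw') h'
  · refine hpos.not_ge ?_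
    rw [mul_mul_mul_comm, mul_mul_mul_comm (x * b 0 * c 1 + _)]
    refine mul_le_mul ?_ ?_ (nonneg hy hy' he he' hf hf' 0 0 1 1)
      (nonneg hx hx' hb hb' hc hc' 0 1 1 0)
    · rw [← sub_nonpos, mixture_slice_minor]
      exact mul_nonpos_of_nonneg_of_nonpos (mul_nonneg hx hx') h
    · rw [← sub_nonpos, mixture_slice_minor]
      exact mul_nonpos_of_nonneg_of_nonpos (mul_nonneg hy hy') h'

instance (x y : State) : Decidable (hamNeighbour x y) := by
  unfold hamNeighbour
  infer_instance

lemma hamNeighbour.symm {x y : State} (h : hamNeighbour x y) : hamNeighbour y x := by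
  simpa only [hamNeighbour, ne_comm, eq_comm] using h

lemma isMode.not_hamNeighbour {p : Tensor} {x y : State} (hx : isMode p x) (hy : isMode p y) :
    ¬ hamNeighbour x y :=
  fun h => lt_asymm (hx y h) (hy x h.symm)

set_option synthInstance.maxSize 1000 in
/-- Four distinct, pairwise non-neighbouring states exhaust a parity class of the cube. -/
lemma exists_parity_class_of_independent : ∀ x₁ x₂ : State, x₁ ≠ x₂ → ¬ hamNeighbour x₁ x₂ →
    ∀ x₃, x₁ ≠ x₃ → x₂ ≠ x₃ → ¬ hamNeighbour x₁ x₃ → ¬ hamNeighbour x₂ x₃ →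
    ∀ x₄, x₁ ≠ x₄ → x₂ ≠ x₄ → x₃ ≠ x₄ → ¬ hamNeighbour x₁ x₄ → ¬ hamNeighbour x₂ x₄ →
    ¬ hamNeighbour x₃ x₄ →
    ∃ n : Fin 2, ∀ y : State, y.1 + y.2.1 + y.2.2 = n →
      y = x₁ ∨ y = x₂ ∨ y = x₃ ∨ y = x₄ := by
  decide

/-- Three reals cannot have pairwise negative products. -/
lemma not_pairwise_mul_neg {x y z : ℝ} (hxy : x * y < 0) (hxz : x * z < 0) (hyz : y * z < 0) :
    False := by
  have h : x * y * (x * z) * (y * z) < 0 :=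
    mul_neg_of_pos_of_neg (mul_pos_of_neg_of_neg hxy hxz) hyz
  nlinarith [sq_nonneg (x * y * z)]

theorem stmt5 (p : Tensor) (hp : inRBM32 p) :
    ¬ ∃ x₁ x₂ x₃ x₄ : State,
      x₁ ≠ x₂ ∧ x₁ ≠ x₃ ∧ x₁ ≠ x₄ ∧ x₂ ≠ x₃ ∧ x₂ ≠ x₄ ∧ x₃ ≠ x₄ ∧
      isMode p x₁ ∧ isMode p x₂ ∧ isMode p x₃ ∧ isMode p x₄ := by
  obtain ⟨⟨hn, -⟩, q, r, s, t, ⟨a, b, c, ha, hb, hc, hq⟩, ⟨a', b', c', ha', hb', hc', hr⟩,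
    ⟨d, e, f, hd, he, hf, hs⟩, ⟨d', e', f', hd', he', hf', ht⟩, hp⟩ := hp
  simp only [hq, hr, hs, ht] at hp
  rintro ⟨x₁, x₂, x₃, x₄, h₁₂, h₁₃, h₁₄, h₂₃, h₂₄, h₃₄, hm₁, hm₂, hm₃, hm₄⟩
  obtain ⟨n, cover⟩ := exists_parity_class_of_independent x₁ x₂ h₁₂ (hm₁.not_hamNeighbour hm₂)
    x₃ h₁₃ h₂₃ (hm₁.not_hamNeighbour hm₃) (hm₂.not_hamNeighbour hm₃)
    x₄ h₁₄ h₂₄ h₃₄ (hm₁.not_hamNeighbour hm₄) (hm₂.not_hamNeighbour hm₄)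
    (hm₃.not_hamNeighbour hm₄)
  have modes : ∀ y : State, y.1 + y.2.1 + y.2.2 = n → isMode p y := by
    intro y hy
    rcases cover y hy with rfl | rfl | rfl | rfl <;> assumption
  have mul_lt : ∀ x x' y y' : State, (x.1 + x.2.1 + x.2.2 = n ∧ x'.1 + x'.2.1 + x'.2.2 = n ∧
      hamNeighbour x y ∧ hamNeighbour x' y') →
      p y.1 y.2.1 y.2.2 * p y'.1 y'.2.1 y'.2.2 < p x.1 x.2.1 x.2.2 * p x'.1 x'.2.1 x'.2.2 :=
    fun x x' y y' ⟨hx, hx', hxy, hxy'⟩ =>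
      mul_lt_mul'' (modes x hx y hxy) (modes x' hx' y' hxy') (hn _ _ _) (hn _ _ _)
  have h₁ := mixture_minors_opposite hb hb' hc hc' he he' hf hf'
    (ha n) (ha' n) (hd n) (hd' n) (ha (n + 1)) (ha' (n + 1)) (hd (n + 1)) (hd' (n + 1))
    (by
      have h := mul_lt (n, 0, 0) (n, 1, 1) (n, 0, 1) (n, 1, 0)
        (by clear * -; decide +revert)
      simpa only [hp] using h)
    (by
      have h := mul_lt (n + 1, 0, 1) (n + 1, 1, 0) (n + 1, 0, 0) (n + 1, 1, 1)
        (by clear * -; decide +revert)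
      simpa only [hp] using h)
  have h₂ := mixture_minors_opposite ha ha' hc hc' hd hd' hf hf'
    (hb n) (hb' n) (he n) (he' n) (hb (n + 1)) (hb' (n + 1)) (he (n + 1)) (he' (n + 1))
    (by
      have h := mul_lt (0, n, 0) (1, n, 1) (0, n, 1) (1, n, 0)
        (by clear * -; decide +revert)
      simpa only [hp, mul_comm (a _), mul_comm (a' _), mul_comm (d _), mul_comm (d' _)] using h)
    (by
      have h := mul_lt (0, n + 1, 1) (1, n + 1, 0) (0, n + 1, 0) (1, n + 1, 1)
        (by clear * -; decide +revert)
      simpa only [hp, mul_comm (a _), mul_comm (a' _), mul_comm (d _), mul_comm (d' _)] using h)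
  have h₃ := mixture_minors_opposite ha ha' hb hb' hd hd' he he'
    (hc n) (hc' n) (hf n) (hf' n) (hc (n + 1)) (hc' (n + 1)) (hf (n + 1)) (hf' (n + 1))
    (by
      have h := mul_lt (0, 0, n) (1, 1, n) (0, 1, n) (1, 0, n)
        (by clear * -; decide +revert)
      simp only [hp] at h
      convert h using 3 <;> ring)
    (by
      have h := mul_lt (0, 1, n + 1) (1, 0, n + 1) (0, 0, n + 1) (1, 1, n + 1)
        (by clear * -; decide +revert)
      simp only [hp] at h
      convert h using 3 <;> ring)
  rw [mul_mul_mul_comm] at h₁ h₂ h₃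
  exact not_pairwise_mul_neg h₃ h₂ h₁
end

section
/- Let p ∈ Δ7 have at least one zero entry (i.e., p lies on the boundary of the simplex). Then p ∈ RBM_{3,2} if and only if for every state x ∈ {0,1}³ with p_x = 0 there exists a Hamming neighbour y of x with p_y = 0. -/
open Real

/-- Every zero of `p` has a Hamming neighbour which is a zero of `p`. -/
def NoIsolatedZero (p : Tensor) : Prop :=
  ∀ i j k, p i j k = 0 → p (i + 1) j k = 0 ∨ p i (j + 1) k = 0 ∨ p i j (k + 1) = 0

theorem Fin.two_add_add_cancel (i x : Fin 2) : i + x + x = i := by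
  revert i x; decide

theorem Fin.two_ne_iff {i j : Fin 2} : i ≠ j ↔ j = i + 1 := by
  revert i j; decide

theorem forall_hamNeighbour_iff (p : Tensor) :
    (∀ x : State, p x.1 x.2.1 x.2.2 = 0 →
        ∃ y : State, hamNeighbour x y ∧ p y.1 y.2.1 y.2.2 = 0) ↔ NoIsolatedZero p := by
  constructor
  · intro h i j k h0
    obtain ⟨⟨i', j', k'⟩, hn, hy⟩ := h (i, j, k) h0
    simp only [hamNeighbour, Fin.two_ne_iff] at hn hy
    rcases hn with ⟨rfl, rfl, rfl⟩ | ⟨rfl, rfl, rfl⟩ | ⟨rfl, rfl, rfl⟩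
    · exact Or.inl hy
    · exact Or.inr (Or.inl hy)
    · exact Or.inr (Or.inr hy)
  · rintro h ⟨i, j, k⟩ h0
    rcases h i j k h0 with hy | hy | hy
    · exact ⟨(i + 1, j, k), by simp [hamNeighbour], hy⟩
    · exact ⟨(i, j + 1, k), by simp [hamNeighbour], hy⟩
    · exact ⟨(i, j, k + 1), by simp [hamNeighbour], hy⟩

namespace rankOne

variable {q : Tensor}

theorem nonneg_s6 (h : rankOne q) (i j k : Fin 2) : 0 ≤ q i j k := by
  obtain ⟨a, b, c, ha, hb, hc, h⟩ := h
  rw [h]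
  exact mul_nonneg (mul_nonneg (ha i) (hb j)) (hc k)

/-- A rank-one tensor vanishing at a state vanishes on a facet of the cube through it. -/
theorem eq_zero_facet (h : rankOne q) {i j k : Fin 2} (h0 : q i j k = 0) :
    (∀ j k, q i j k = 0) ∨ (∀ i k, q i j k = 0) ∨ (∀ i j, q i j k = 0) := by
  obtain ⟨a, b, c, -, -, -, h⟩ := h
  simp only [h, mul_eq_zero] at h0
  rcases h0 with (h0 | h0) | h0
  · exact Or.inl fun j k => by simp [h, h0]
  · exact Or.inr (Or.inl fun i k => by simp [h, h0])
  · exact Or.inr (Or.inr fun i j => by simp [h, h0])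

theorem reindex (h : rankOne q) (f g e : Fin 2 → Fin 2) :
    rankOne fun i j k => q (f i) (g j) (e k) := by
  obtain ⟨a, b, c, ha, hb, hc, h⟩ := h
  exact ⟨a ∘ f, b ∘ g, c ∘ e, fun i => ha _, fun i => hb _, fun i => hc _,
    fun i j k => h _ _ _⟩

theorem swap_left (h : rankOne q) : rankOne fun i j k => q j i k := by
  obtain ⟨a, b, c, ha, hb, hc, h⟩ := h
  exact ⟨b, a, c, hb, ha, hc, fun i j k => by simp only [h]; ring⟩

theorem swap_right (h : rankOne q) : rankOne fun i j k => q i k j := by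
  obtain ⟨a, b, c, ha, hb, hc, h⟩ := h
  exact ⟨a, c, b, ha, hc, hb, fun i j k => by simp only [h]; ring⟩

/-- Two facets through a common vertex of the 3-cube share an edge. -/
theorem exists_neighbour_eq_zero {r : Tensor} (hq : rankOne q) (hr : rankOne r)
    {i j k : Fin 2} (h0 : q i j k + r i j k = 0) :
    q (i + 1) j k + r (i + 1) j k = 0 ∨ q i (j + 1) k + r i (j + 1) k = 0 ∨
      q i j (k + 1) + r i j (k + 1) = 0 := by
  have h1 := hq.nonneg_s6 i j k
  have h2 := hr.nonneg_s6 i j k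
  have hq0 : q i j k = 0 := by linarith
  have hr0 : r i j k = 0 := by linarith
  rcases hq.eq_zero_facet hq0 with h | h | h <;>
    rcases hr.eq_zero_facet hr0 with h' | h' | h' <;> simp [h, h']

end rankOne

namespace NoIsolatedZero

variable {p : Tensor}

theorem translate (h : NoIsolatedZero p) (x y z : Fin 2) :
    NoIsolatedZero fun i j k => p (i + x) (j + y) (k + z) := by
  intro i j k h0
  simpa only [add_right_comm] using h _ _ _ h0

theorem swap_left (h : NoIsolatedZero p) : NoIsolatedZero fun i j k => p j i k := by
  intro i j k h0
  have := h _ _ _ h0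
  tauto

theorem swap_right (h : NoIsolatedZero p) : NoIsolatedZero fun i j k => p i k j := by
  intro i j k h0
  have := h _ _ _ h0
  tauto

end NoIsolatedZero

namespace IsMixtureProduct

variable {p : Tensor}

theorem noIsolatedZero (h : IsMixtureProduct p) : NoIsolatedZero p := by
  obtain ⟨q, r, s, t, hq, hr, hs, ht, h⟩ := h
  intro i j k h0
  simp only [h, mul_eq_zero] at h0 ⊢
  rcases h0 with h0 | h0
  · have := hq.exists_neighbour_eq_zero hr h0
    tauto
  · have := hs.exists_neighbour_eq_zero ht h0
    tauto

theorem of_translate (x y z : Fin 2)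
    (h : IsMixtureProduct fun i j k => p (i + x) (j + y) (k + z)) : IsMixtureProduct p := by
  obtain ⟨q, r, s, t, hq, hr, hs, ht, h⟩ := h
  refine ⟨_, _, _, _, hq.reindex (· + x) (· + y) (· + z), hr.reindex (· + x) (· + y) (· + z),
    hs.reindex (· + x) (· + y) (· + z), ht.reindex (· + x) (· + y) (· + z), fun i j k => ?_⟩
  rw [← h]
  simp only [Fin.two_add_add_cancel]

theorem of_swap_left (h : IsMixtureProduct fun i j k => p j i k) : IsMixtureProduct p := by
  obtain ⟨q, r, s, t, hq, hr, hs, ht, h⟩ := h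
  exact ⟨_, _, _, _, hq.swap_left, hr.swap_left, hs.swap_left, ht.swap_left,
    fun i j k => h j i k⟩

theorem of_swap_right (h : IsMixtureProduct fun i j k => p i k j) : IsMixtureProduct p := by
  obtain ⟨q, r, s, t, hq, hr, hs, ht, h⟩ := h
  exact ⟨_, _, _, _, hq.swap_right, hr.swap_right, hs.swap_right, ht.swap_right,
    fun i j k => h i k j⟩

theorem of_facet_eq_zero (hp : ∀ i j k, 0 ≤ p i j k) (h0 : ∀ j k, p 0 j k = 0) :
    IsMixtureProduct p := by
  refine ⟨fun i j k => ![0, 1] i * ![1, 0] j * p 1 0 k,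
    fun i j k => ![0, 1] i * ![0, 1] j * p 1 1 k, fun _ _ _ => 1 * 1 * 1, fun _ _ _ => 0 * 0 * 0,
    ⟨![0, 1], ![1, 0], p 1 0, ?_, ?_, hp 1 0, fun _ _ _ => rfl⟩,
    ⟨![0, 1], ![0, 1], p 1 1, ?_, ?_, hp 1 1, fun _ _ _ => rfl⟩,
    ⟨fun _ => 1, fun _ => 1, fun _ => 1, ?_, ?_, ?_, fun _ _ _ => rfl⟩,
    ⟨fun _ => 0, fun _ => 0, fun _ => 0, ?_, ?_, ?_, fun _ _ _ => rfl⟩, fun i j k => ?_⟩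
  any_goals simp [Fin.forall_fin_two]
  fin_cases i <;> fin_cases j <;> simp [h0]

theorem of_edge_parametrization {α β : ℝ} {c d e h : Fin 2 → ℝ} (hα : 0 ≤ α) (hβ : 0 ≤ β)
    (hc : ∀ k, 0 ≤ c k) (hd : ∀ k, 0 ≤ d k) (he : ∀ k, 0 ≤ e k) (hh : ∀ k, 0 ≤ h k)
    (h00 : ∀ k, p 0 0 k = 0) (h01 : ∀ k, p 0 1 k = d k * h k) (h10 : ∀ k, p 1 0 k = c k * h k)
    (h11 : ∀ k, p 1 1 k = (α * c k + β * d k) * (h k + e k)) : IsMixtureProduct p := by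
  refine ⟨fun i j k => ![0, 1] i * ![1, α] j * c k, fun i j k => ![1, β] i * ![0, 1] j * d k,
    fun _ _ k => 1 * 1 * h k, fun i j k => ![0, 1] i * ![0, 1] j * e k,
    ⟨![0, 1], ![1, α], c, ?_, ?_, hc, fun _ _ _ => rfl⟩,
    ⟨![1, β], ![0, 1], d, ?_, ?_, hd, fun _ _ _ => rfl⟩,
    ⟨fun _ => 1, fun _ => 1, h, ?_, ?_, hh, fun _ _ _ => rfl⟩,
    ⟨![0, 1], ![0, 1], e, ?_, ?_, he, fun _ _ _ => rfl⟩, fun i j k => ?_⟩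
  any_goals simp [Fin.forall_fin_two, hα, hβ]
  fin_cases i <;> fin_cases j <;> simp [h00, h01, h10, h11]

theorem of_edge_eq_zero_of_opposite_pos (hp : ∀ i j k, 0 ≤ p i j k) (h00 : ∀ k, p 0 0 k = 0)
    (h11 : ∀ k, 0 < p 1 1 k) : IsMixtureProduct p := by
  have hfac : ∀ k, ∃ d c h : ℝ, 0 ≤ d ∧ 0 ≤ c ∧ 0 < c + d ∧ 0 ≤ h ∧ h ≤ 1 ∧
      p 0 1 k = d * h ∧ p 1 0 k = c * h := by
    intro k
    rcases (add_nonneg (hp 1 0 k) (hp 0 1 k)).eq_or_lt with h | h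
    · have h1 := hp 1 0 k
      have h2 := hp 0 1 k
      exact ⟨1, 1, 0, by norm_num, by norm_num, by norm_num, le_rfl, zero_le_one,
        by linarith, by linarith⟩
    · exact ⟨p 0 1 k, p 1 0 k, 1, hp _ _ _, hp _ _ _, h, zero_le_one, le_rfl,
        (mul_one _).symm, (mul_one _).symm⟩
  choose d c h hd hc hcd hh hh1 h01 h10 using hfac
  obtain ⟨ε, hε, hle⟩ : ∃ ε > 0, ∀ k, ε ≤ p 1 1 k / (c k + d k) :=
    ⟨min (p 1 1 0 / (c 0 + d 0)) (p 1 1 1 / (c 1 + d 1)),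
      lt_min (div_pos (h11 0) (hcd 0)) (div_pos (h11 1) (hcd 1)),
      Fin.forall_fin_two.2 ⟨min_le_left _ _, min_le_right _ _⟩⟩
  refine of_edge_parametrization (e := fun k => p 1 1 k / (ε * (c k + d k)) - h k)
    hε.le hε.le hc hd (fun k => ?_) hh h00 h01 h10 fun k => ?_
  · have h1 : 1 ≤ p 1 1 k / (ε * (c k + d k)) := by
      rw [one_le_div (mul_pos hε (hcd k))]
      exact (le_div_iff₀ (hcd k)).1 (hle k)
    linarith [hh1 k]
  · have := (hcd k).ne'
    have := hε.ne'
    rw [add_sub_cancel, ← mul_add]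
    field_simp

theorem of_facet_edges_eq_zero (hp : ∀ i j k, 0 ≤ p i j k) (h00 : ∀ k, p 0 0 k = 0)
    (h01 : p 0 1 0 = 0) (h11 : p 1 1 0 = 0) : IsMixtureProduct p := by
  rcases (hp 0 1 1).eq_or_lt with hu | hu
  · exact of_facet_eq_zero hp <| Fin.forall_fin_two.2
      ⟨h00, Fin.forall_fin_two.2 ⟨h01, hu.symm⟩⟩
  · have hw := hp 1 1 1
    refine of_edge_parametrization (α := 0) (β := p 1 1 1 / (p 0 1 1 + p 1 1 1))
      (c := p 1 0) (d := p 0 1) (h := fun _ => 1) (e := ![0, p 1 1 1 / p 0 1 1])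
      le_rfl (by positivity) (hp 1 0) (hp 0 1) ?_ (fun _ => zero_le_one) h00
      (fun _ => (mul_one _).symm) (fun _ => (mul_one _).symm) ?_
    · simp only [Fin.forall_fin_two, Matrix.cons_val_zero, Matrix.cons_val_one]
      exact ⟨le_rfl, by positivity⟩
    · simp only [Fin.forall_fin_two, Matrix.cons_val_zero, Matrix.cons_val_one]
      refine ⟨by rw [h01, h11]; ring, ?_⟩
      field_simp
      ring

theorem of_edge_eq_zero (hp : ∀ i j k, 0 ≤ p i j k) (hz : NoIsolatedZero p)
    (h00 : ∀ k, p 0 0 k = 0) : IsMixtureProduct p := by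
  by_cases hpos : ∀ k, 0 < p 1 1 k
  · exact of_edge_eq_zero_of_opposite_pos hp h00 hpos
  push Not at hpos
  obtain ⟨k, hk⟩ := hpos
  have hk : p 1 1 k = 0 := le_antisymm hk (hp _ _ _)
  rcases hz 1 1 k hk with h | h | h
  · refine of_translate 0 0 k
      (of_facet_edges_eq_zero (fun _ _ _ => hp _ _ _) (fun _ => h00 _) ?_ ?_)
    · simpa using h
    · simpa using hk
  · refine of_translate 0 0 k (of_swap_left
      (of_facet_edges_eq_zero (fun _ _ _ => hp _ _ _) (fun _ => h00 _) ?_ ?_))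
    · simpa using h
    · simpa using hk
  · have h11 : ∀ l, p 1 1 l = 0 := by
      intro l
      rcases eq_or_ne k l with rfl | hl
      · exact hk
      · rwa [Fin.two_ne_iff.1 hl]
    exact of_edge_parametrization (α := 0) (β := 0) (c := p 1 0) (d := p 0 1)
      (h := fun _ => 1) (e := fun _ => 0) le_rfl le_rfl (hp 1 0) (hp 0 1) (fun _ => le_rfl)
      (fun _ => zero_le_one) h00 (fun _ => (mul_one _).symm) (fun _ => (mul_one _).symm)
      (fun k => by rw [h11]; ring)

theorem of_adjacent_zeros (hp : ∀ i j k, 0 ≤ p i j k) (hz : NoIsolatedZero p) {i j k : Fin 2}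
    (h : p i j k = 0) (h' : p i j (k + 1) = 0) : IsMixtureProduct p := by
  refine of_translate i j k
    (of_edge_eq_zero (fun _ _ _ => hp _ _ _) (hz.translate i j k) (Fin.forall_fin_two.2 ⟨?_, ?_⟩))
  · simpa using h
  · simpa [add_comm] using h'

theorem of_noIsolatedZero (hp : ∀ i j k, 0 ≤ p i j k) (hz : NoIsolatedZero p)
    {i j k : Fin 2} (h : p i j k = 0) : IsMixtureProduct p := by
  rcases hz i j k h with h' | h' | h'
  · exact of_swap_left (of_swap_right (of_adjacent_zeros (i := j) (j := k) (k := i)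
      (fun _ _ _ => hp _ _ _) hz.swap_left.swap_right h h'))
  · exact of_swap_right (of_adjacent_zeros (fun _ _ _ => hp _ _ _) hz.swap_right h h')
  · exact of_adjacent_zeros hp hz h h'

end IsMixtureProduct

theorem stmt6 (p : Tensor) (hp : isDist p) (hbd : ∃ i j k, p i j k = 0) :
    inRBM32 p ↔
      ∀ x : State, p x.1 x.2.1 x.2.2 = 0 →
        ∃ y : State, hamNeighbour x y ∧ p y.1 y.2.1 y.2.2 = 0 := by
  rw [forall_hamNeighbour_iff]
  obtain ⟨i, j, k, h⟩ := hbd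
  exact ⟨fun hr => IsMixtureProduct.noIsolatedZero hr.2,
    fun hz => ⟨hp, IsMixtureProduct.of_noIsolatedZero hp.1 hz h⟩⟩
end

section
/- Every distribution in RBM_{3,2} lies in M_{3,3}; that is, RBM_{3,2} ⊆ M_{3,3}. -/
open Real

/-- `p` is a sum of three nonnegative rank-one tensors. -/
def IsSumThree (p : Tensor) : Prop :=
  ∃ q r s : Tensor, rankOne q ∧ rankOne r ∧ rankOne s ∧
    ∀ i j k, p i j k = q i j k + r i j k + s i j k

/-- A nonnegative `2 × 2` matrix with nonnegative determinant is a nonnegative rank-one matrix plus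
a nonnegative multiple of the matrix unit in position `(0, 0)`. -/
lemma exists_rankOne_add_single (M : Fin 2 → Fin 2 → ℝ) (hM : ∀ i j, 0 ≤ M i j)
    (h : M 0 1 * M 1 0 ≤ M 0 0 * M 1 1) :
    ∃ (u v : Fin 2 → ℝ) (x : ℝ), (∀ i, 0 ≤ u i) ∧ (∀ i, 0 ≤ v i) ∧ 0 ≤ x ∧
      M 0 0 = u 0 * v 0 + x ∧ M 0 1 = u 0 * v 1 ∧ M 1 0 = u 1 * v 0 ∧ M 1 1 = u 1 * v 1 := by
  rcases (hM 1 1).eq_or_lt with hd | hd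
  · have hbc : M 0 1 * M 1 0 = 0 :=
      le_antisymm (by simpa [← hd] using h) (mul_nonneg (hM 0 1) (hM 1 0))
    rcases mul_eq_zero.1 hbc with h0 | h0
    · exact ⟨fun i => M i 0, ![1, 0], 0, fun i => hM i 0, by simp [Fin.forall_fin_two],
        le_rfl, by simp, by simp [h0], by simp, by simp [← hd]⟩
    · exact ⟨![1, 0], M 0, 0, by simp [Fin.forall_fin_two], hM 0,
        le_rfl, by simp, by simp, by simp [h0], by simp [← hd]⟩
  · refine ⟨fun i => M i 1 / M 1 1, M 1, M 0 0 - M 0 1 / M 1 1 * M 1 0,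
      fun i => div_nonneg (hM i 1) hd.le, hM 1, ?_, by ring, ?_, ?_, ?_⟩
    · rw [sub_nonneg, div_mul_eq_mul_div, div_le_iff₀ hd]
      exact h
    all_goals field_simp

lemma isSumThree_of_slices_det_nonneg {p : Tensor} (hp : ∀ i j k, 0 ≤ p i j k)
    (h : ∀ i, p i 0 1 * p i 1 0 ≤ p i 0 0 * p i 1 1) : IsSumThree p := by
  choose u v x hu hv hx h00 h01 h10 h11 using
    fun i => exists_rankOne_add_single (p i) (hp i) (h i)
  refine ⟨_, _, _, ⟨![1, 0], u 0, v 0, by simp [Fin.forall_fin_two], hu 0, hv 0, fun _ _ _ => rfl⟩,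
    ⟨![0, 1], u 1, v 1, by simp [Fin.forall_fin_two], hu 1, hv 1, fun _ _ _ => rfl⟩,
    ⟨x, ![1, 0], ![1, 0], hx, by simp [Fin.forall_fin_two], by simp [Fin.forall_fin_two],
      fun _ _ _ => rfl⟩, ?_⟩
  simp [Fin.forall_fin_two, h00, h01, h10, h11]

lemma IsSumThree.of_flip {p : Tensor} (h : IsSumThree fun i j k => p i j (1 - k)) :
    IsSumThree p := by
  obtain ⟨q, r, s, hq, hr, hs, h⟩ := h
  have key {q : Tensor} (hq : rankOne q) : rankOne fun i j k => q i j (1 - k) := by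
    obtain ⟨a, b, c, ha, hb, hc, h⟩ := hq
    exact ⟨a, b, fun k => c (1 - k), ha, hb, fun k => hc _, fun i j k => h i j _⟩
  exact ⟨_, _, _, key hq, key hr, key hs, fun i j k => by simpa using h i j (1 - k)⟩

lemma IsSumThree.of_rotate {p : Tensor} (h : IsSumThree fun i j k => p j k i) :
    IsSumThree p := by
  obtain ⟨q, r, s, hq, hr, hs, h⟩ := h
  have key {q : Tensor} (hq : rankOne q) : rankOne fun i j k => q k i j := by
    obtain ⟨a, b, c, ha, hb, hc, h⟩ := hq
    exact ⟨b, c, a, hb, hc, ha, fun i j k => (h k i j).trans (by ring)⟩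
  exact ⟨_, _, _, key hq, key hr, key hs, fun i j k => h k i j⟩

lemma isSumThree_of_C1 {p : Tensor} (hp : ∀ i j k, 0 ≤ p i j k) (h : C1 p) : IsSumThree p :=
  isSumThree_of_slices_det_nonneg hp (Fin.forall_fin_two.2 h)

lemma isSumThree_of_C2 {p : Tensor} (hp : ∀ i j k, 0 ≤ p i j k) (h : C2 p) : IsSumThree p :=
  .of_flip (isSumThree_of_C1 (fun _ _ _ => hp _ _ _) h)

lemma isSumThree_of_C5 {p : Tensor} (hp : ∀ i j k, 0 ≤ p i j k) (h : C5 p) : IsSumThree p :=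
  .of_rotate (isSumThree_of_C1 (fun _ _ _ => hp _ _ _)
    (by simpa [C1, C5, mul_comm] using h))

lemma isSumThree_of_C6 {p : Tensor} (hp : ∀ i j k, 0 ≤ p i j k) (h : C6 p) : IsSumThree p :=
  .of_rotate (isSumThree_of_C2 (fun _ _ _ => hp _ _ _)
    (by simpa [C2, C6, mul_comm] using h))

lemma isSumThree_of_C3 {p : Tensor} (hp : ∀ i j k, 0 ≤ p i j k) (h : C3 p) : IsSumThree p :=
  .of_rotate (isSumThree_of_C5 (fun _ _ _ => hp _ _ _)
    (by simpa [C3, C5, mul_comm] using h))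

lemma isSumThree_of_C4 {p : Tensor} (hp : ∀ i j k, 0 ≤ p i j k) (h : C4 p) : IsSumThree p :=
  .of_rotate (isSumThree_of_C6 (fun _ _ _ => hp _ _ _)
    (by simpa [C4, C6, mul_comm] using h))

/-- The slice determinants of a sum of two nonnegative rank-one tensors have constant signs in each
of the three directions, and the product of the three signs is nonnegative. -/
lemma rankOne.add_sign_pattern {q r : Tensor} (hq : rankOne q) (hr : rankOne r) :
    (C1 (q + r) ∧ C3 (q + r) ∧ C5 (q + r)) ∨ (C1 (q + r) ∧ C4 (q + r) ∧ C6 (q + r)) ∨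
    (C2 (q + r) ∧ C3 (q + r) ∧ C6 (q + r)) ∨ (C2 (q + r) ∧ C4 (q + r) ∧ C5 (q + r)) := by
  obtain ⟨a, b, c, ha, hb, hc, hq⟩ := hq
  obtain ⟨a', b', c', ha', hb', hc', hr⟩ := hr
  set α := a 0 * a' 1 - a 1 * a' 0
  set β := b 0 * b' 1 - b 1 * b' 0
  set γ := c 0 * c' 1 - c 1 * c' 0
  have wa i : 0 ≤ a i * a' i := mul_nonneg (ha i) (ha' i)
  have wb i : 0 ≤ b i * b' i := mul_nonneg (hb i) (hb' i)
  have wc i : 0 ≤ c i * c' i := mul_nonneg (hc i) (hc' i)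
  have h1 (h : 0 ≤ β * γ) : C1 (q + r) := by
    constructor <;> simp only [Pi.add_apply, hq, hr]
    · linear_combination mul_nonneg (wa 0) h
    · linear_combination mul_nonneg (wa 1) h
  have h2 (h : 0 ≤ -(β * γ)) : C2 (q + r) := by
    constructor <;> simp only [Pi.add_apply, hq, hr]
    · linear_combination mul_nonneg (wa 0) h
    · linear_combination mul_nonneg (wa 1) h
  have h3 (h : 0 ≤ α * γ) : C3 (q + r) := by
    constructor <;> simp only [Pi.add_apply, hq, hr]
    · linear_combination mul_nonneg (wb 0) h
    · linear_combination mul_nonneg (wb 1) h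
  have h4 (h : 0 ≤ -(α * γ)) : C4 (q + r) := by
    constructor <;> simp only [Pi.add_apply, hq, hr]
    · linear_combination mul_nonneg (wb 0) h
    · linear_combination mul_nonneg (wb 1) h
  have h5 (h : 0 ≤ α * β) : C5 (q + r) := by
    constructor <;> simp only [Pi.add_apply, hq, hr]
    · linear_combination mul_nonneg (wc 0) h
    · linear_combination mul_nonneg (wc 1) h
  have h6 (h : 0 ≤ -(α * β)) : C6 (q + r) := by
    constructor <;> simp only [Pi.add_apply, hq, hr]
    · linear_combination mul_nonneg (wc 0) h
    · linear_combination mul_nonneg (wc 1) h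
  rcases le_total 0 α with hA | hA <;> rcases le_total 0 β with hB | hB <;>
    rcases le_total 0 γ with hC | hC
  · exact .inl ⟨h1 (mul_nonneg hB hC), h3 (mul_nonneg hA hC), h5 (mul_nonneg hA hB)⟩
  · exact .inr (.inr (.inr ⟨h2 (neg_nonneg.2 (mul_nonpos_of_nonneg_of_nonpos hB hC)),
      h4 (neg_nonneg.2 (mul_nonpos_of_nonneg_of_nonpos hA hC)), h5 (mul_nonneg hA hB)⟩))
  · exact .inr (.inr (.inl ⟨h2 (neg_nonneg.2 (mul_nonpos_of_nonpos_of_nonneg hB hC)),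
      h3 (mul_nonneg hA hC), h6 (neg_nonneg.2 (mul_nonpos_of_nonneg_of_nonpos hA hB))⟩))
  · exact .inr (.inl ⟨h1 (mul_nonneg_of_nonpos_of_nonpos hB hC),
      h4 (neg_nonneg.2 (mul_nonpos_of_nonneg_of_nonpos hA hC)),
      h6 (neg_nonneg.2 (mul_nonpos_of_nonneg_of_nonpos hA hB))⟩)
  · exact .inr (.inl ⟨h1 (mul_nonneg hB hC),
      h4 (neg_nonneg.2 (mul_nonpos_of_nonpos_of_nonneg hA hC)),
      h6 (neg_nonneg.2 (mul_nonpos_of_nonpos_of_nonneg hA hB))⟩)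
  · exact .inr (.inr (.inl ⟨h2 (neg_nonneg.2 (mul_nonpos_of_nonneg_of_nonpos hB hC)),
      h3 (mul_nonneg_of_nonpos_of_nonpos hA hC),
      h6 (neg_nonneg.2 (mul_nonpos_of_nonpos_of_nonneg hA hB))⟩))
  · exact .inr (.inr (.inr ⟨h2 (neg_nonneg.2 (mul_nonpos_of_nonpos_of_nonneg hB hC)),
      h4 (neg_nonneg.2 (mul_nonpos_of_nonpos_of_nonneg hA hC)),
      h5 (mul_nonneg_of_nonpos_of_nonpos hA hB)⟩))
  · exact .inl ⟨h1 (mul_nonneg_of_nonpos_of_nonpos hB hC),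
      h3 (mul_nonneg_of_nonpos_of_nonpos hA hC), h5 (mul_nonneg_of_nonpos_of_nonpos hA hB)⟩

theorem stmt8 (p : Tensor) (hp : inRBM32 p) : inM33 p := by
  obtain ⟨hd, q, r, s, t, hq, hr, hs, ht, h⟩ := hp
  refine ⟨hd, ?_⟩
  change IsSumThree p
  have hX i j k : 0 ≤ (q + r) i j k := add_nonneg (hq.nonneg i j k) (hr.nonneg i j k)
  have hY i j k : 0 ≤ (s + t) i j k := add_nonneg (hs.nonneg i j k) (ht.nonneg i j k)
  have hmul i j k : p i j k = (q + r) i j k * (s + t) i j k := h i j k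
  have sX := hq.add_sign_pattern hr
  have sY := hs.add_sign_pattern ht
  generalize q + r = X at *
  generalize s + t = Y at *
  have mul_det {i j k i' j' k' l m n l' m' n' : Fin 2}
      (hx : X i j k * X i' j' k' ≤ X l m n * X l' m' n')
      (hy : Y i j k * Y i' j' k' ≤ Y l m n * Y l' m' n') :
      p i j k * p i' j' k' ≤ p l m n * p l' m' n' := by
    simp only [hmul]
    linear_combination mul_le_mul hx hy (mul_nonneg (hY _ _ _) (hY _ _ _))
      (mul_nonneg (hX _ _ _) (hX _ _ _))
  have h1 (hx : C1 X) (hy : C1 Y) : IsSumThree p :=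
    isSumThree_of_C1 hd.1 ⟨mul_det hx.1 hy.1, mul_det hx.2 hy.2⟩
  have h2 (hx : C2 X) (hy : C2 Y) : IsSumThree p :=
    isSumThree_of_C2 hd.1 ⟨mul_det hx.1 hy.1, mul_det hx.2 hy.2⟩
  have h3 (hx : C3 X) (hy : C3 Y) : IsSumThree p :=
    isSumThree_of_C3 hd.1 ⟨mul_det hx.1 hy.1, mul_det hx.2 hy.2⟩
  have h4 (hx : C4 X) (hy : C4 Y) : IsSumThree p :=
    isSumThree_of_C4 hd.1 ⟨mul_det hx.1 hy.1, mul_det hx.2 hy.2⟩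
  have h5 (hx : C5 X) (hy : C5 Y) : IsSumThree p :=
    isSumThree_of_C5 hd.1 ⟨mul_det hx.1 hy.1, mul_det hx.2 hy.2⟩
  have h6 (hx : C6 X) (hy : C6 Y) : IsSumThree p :=
    isSumThree_of_C6 hd.1 ⟨mul_det hx.1 hy.1, mul_det hx.2 hy.2⟩
  rcases sX with ⟨x, y, z⟩ | ⟨x, y, z⟩ | ⟨x, y, z⟩ | ⟨x, y, z⟩ <;>
    rcases sY with ⟨x', y', z'⟩ | ⟨x', y', z'⟩ | ⟨x', y', z'⟩ | ⟨x', y', z'⟩ <;>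
    first
    | exact h1 x x'
    | exact h2 x x'
    | exact h3 y y'
    | exact h4 y y'
    | exact h5 z z'
    | exact h6 z z'
end
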